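/- Let u ∈ S_n. The multiplication map (x_u, x^u) ↦ x_u · x^u is a bijection from N^u × N(u) onto N ∩ G_0 u = {x ∈ N : x u⁻¹ ∈ G_0}. Its inverse sends x to the pair (x_u, x^u) given by x_u = [u [u⁻¹ [x u⁻¹]_+ u]_-]_+ and x^u = [u⁻¹ [x u⁻¹]_+ u]_+, where all the Gaussian factors appearing in these formulas exist. Moreover, if x is totally nonnegative, then x_u is totally nonnegative (hence x_u ∈ Y°_u). -/

import Mathlib

open scoped Classical

namespace BruhatTNN

abbrev Mat (n : ℕ) := Matrix (Fin n) (Fin n) ℝ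

/-- `x` is upper unitriangular. -/
def upperUni {n : ℕ} (x : Mat n) : Prop :=
  (∀ i, x i i = 1) ∧ ∀ i j : Fin n, j < i → x i j = 0

/-- `x` is lower unitriangular. -/
def lowerUni {n : ℕ} (x : Mat n) : Prop :=
  (∀ i, x i i = 1) ∧ ∀ i j : Fin n, i < j → x i j = 0

/-- `x` is invertible upper triangular (`x ∈ B`). -/
def upperTriInv {n : ℕ} (x : Mat n) : Prop :=
  IsUnit x.det ∧ ∀ i j : Fin n, j < i → x i j = 0

/-- `x` is invertible lower triangular (`x ∈ B_-`). -/
def lowerTriInv {n : ℕ} (x : Mat n) : Prop :=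
  IsUnit x.det ∧ ∀ i j : Fin n, i < j → x i j = 0

/-- `x` is invertible diagonal (`x ∈ H`). -/
def diagInv {n : ℕ} (x : Mat n) : Prop :=
  IsUnit x.det ∧ ∀ i j : Fin n, i ≠ j → x i j = 0

/-- `x` admits a Gaussian decomposition (`x ∈ G_0`). -/
def hasGauss {n : ℕ} (x : Mat n) : Prop :=
  ∃ a d b : Mat n, lowerUni a ∧ diagInv d ∧ upperUni b ∧ x = a * d * b

/-- The factor `[x]_-` of the Gaussian decomposition (junk value `1` if none exists). -/
noncomputable def gaussMinus {n : ℕ} (x : Mat n) : Mat n :=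
  if h : hasGauss x then h.choose else 1

/-- The factor `[x]_0` of the Gaussian decomposition (junk value `1` if none exists). -/
noncomputable def gaussDiag {n : ℕ} (x : Mat n) : Mat n :=
  if h : hasGauss x then h.choose_spec.choose else 1

/-- The factor `[x]_+` of the Gaussian decomposition (junk value `1` if none exists). -/
noncomputable def gaussPlus {n : ℕ} (x : Mat n) : Mat n :=
  if h : hasGauss x then h.choose_spec.choose_spec.choose else 1

/-- The permutation matrix of `w`, with entry `1` in position `(w j, j)`. -/
def permMat {n : ℕ} (w : Equiv.Perm (Fin n)) : Mat n :=
  Matrix.of fun i j => if i = w j then (1 : ℝ) else 0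

/-- The minor of `x` with row set `I` and column set `J` (taken in increasing order). -/
def minorOf {n : ℕ} (x : Mat n) (k : ℕ) (I J : Finset (Fin n))
    (hI : I.card = k) (hJ : J.card = k) : ℝ :=
  Matrix.det (Matrix.of fun a b : Fin k => x (I.orderEmbOfFin hI a) (J.orderEmbOfFin hJ b))

/-- `x` is totally nonnegative: all its minors are nonnegative. -/
def totNonneg {n : ℕ} (x : Mat n) : Prop :=
  ∀ (k : ℕ) (I J : Finset (Fin n)) (hI : I.card = k) (hJ : J.card = k),
    0 ≤ minorOf x k I J hI hJ

/-- The Bruhat order on the symmetric group. -/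
def bruhatLE {n : ℕ} (u v : Equiv.Perm (Fin n)) : Prop :=
  ∀ i j : Fin n,
    (Finset.univ.filter fun k : Fin n => k ≤ i ∧ j ≤ u k).card ≤
    (Finset.univ.filter fun k : Fin n => k ≤ i ∧ j ≤ v k).card

/-- The double coset `B_- w B_-`. -/
def doubleCosetBm {n : ℕ} (w : Equiv.Perm (Fin n)) : Set (Mat n) :=
  {x | ∃ b₁ b₂ : Mat n, lowerTriInv b₁ ∧ lowerTriInv b₂ ∧ x = b₁ * permMat w * b₂}

/-- `N^w = B_- w B_- ∩ N`. -/
def Ncell {n : ℕ} (w : Equiv.Perm (Fin n)) : Set (Mat n) :=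
  {x | upperUni x ∧ x ∈ doubleCosetBm w}

/-- `N_-(w) = w⁻¹ N w ∩ N_-`. -/
def Nminus {n : ℕ} (w : Equiv.Perm (Fin n)) : Set (Mat n) :=
  {x | lowerUni x ∧ ∃ y : Mat n, upperUni y ∧ x = permMat w⁻¹ * y * permMat w}

/-- `N(w) = w⁻¹ N w ∩ N`. -/
def Ngrp {n : ℕ} (w : Equiv.Perm (Fin n)) : Set (Mat n) :=
  {x | upperUni x ∧ ∃ y : Mat n, upperUni y ∧ x = permMat w⁻¹ * y * permMat w}

/-- The totally positive cell `Y°_w = Y ∩ B_- w B_-`. -/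
def Ycirc {n : ℕ} (w : Equiv.Perm (Fin n)) : Set (Mat n) :=
  {x | upperUni x ∧ totNonneg x ∧ x ∈ doubleCosetBm w}

/-- `Y_{≥ u} = ⋃_{v ≥ u} Y°_v`. -/
def Yge {n : ℕ} (u : Equiv.Perm (Fin n)) : Set (Mat n) :=
  {x | ∃ v, bruhatLE u v ∧ x ∈ Ycirc v}

/-- `A = u⁻¹ [x u⁻¹]_+ u`. -/
noncomputable def Amat {n : ℕ} (u : Equiv.Perm (Fin n)) (x : Mat n) : Mat n :=
  permMat u⁻¹ * gaussPlus (x * permMat u⁻¹) * permMat u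

/-- The projection `π_u(x) = [u [u⁻¹ [x u⁻¹]_+ u]_-]_+`. -/
noncomputable def piMap {n : ℕ} (u : Equiv.Perm (Fin n)) (x : Mat n) : Mat n :=
  gaussPlus (permMat u * gaussMinus (Amat u x))

/-- `str(M)`: the sum of the matrix entries immediately above the main diagonal. -/
def strAbove {n : ℕ} (M : Mat n) : ℝ :=
  ∑ p : Fin n × Fin n, if (p.1 : ℕ) + 1 = (p.2 : ℕ) then M p.1 p.2 else 0

/-- The number of inversions (the length) of a permutation. -/
def invNum {n : ℕ} (w : Equiv.Perm (Fin n)) : ℕ :=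
  (Finset.univ.filter fun p : Fin n × Fin n => p.1 < p.2 ∧ w p.2 < w p.1).card

section Gauss

variable {n : ℕ}

open Matrix

/-- The leading `k × k` block of `M` (indices `≤ k`), completed by the identity. -/
def leadBlock (k : Fin n) (M : Mat n) : Mat n :=
  of fun i j => if i ≤ k ∧ j ≤ k then M i j else if i = j then 1 else 0

/-- The rows of `M` of index at most `k`, the other rows being replaced by zero. -/
def topRows (k : Fin n) (M : Mat n) : Mat n :=
  of fun i j => if i ≤ k then M i j else 0

/-- The unipotent upper triangular Gaussian factor, as an explicit rational function. -/
noncomputable def plusFormula (M : Mat n) : Mat n :=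
  of fun k l => ((leadBlock k M)⁻¹ * topRows k M) k l

lemma leadBlock_mul (k : Fin n) {L b : Mat n} (hL : ∀ i j : Fin n, i < j → L i j = 0) :
    leadBlock k (L * b) = leadBlock k L * leadBlock k b := by
  ext i j
  rw [mul_apply]
  by_cases hi : i ≤ k
  · by_cases hj : j ≤ k
    · simp only [leadBlock, of_apply, hi, hj, and_self, if_true, true_and, mul_apply, and_true]
      refine Finset.sum_congr rfl fun m _ => ?_
      by_cases hm : m ≤ k
      · simp [hm]
      · have h1 : i < m := lt_of_le_of_lt hi (not_le.1 hm)
        simp [hm, h1.ne, hL i m h1]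
    · have hij : i ≠ j := by rintro rfl; exact hj hi
      simp only [leadBlock, of_apply, hi, hj, and_false, if_false, hij, true_and]
      refine (Finset.sum_eq_zero fun m _ => ?_).symm
      by_cases hm : m ≤ k
      · have hmj : m ≠ j := by rintro rfl; exact hj hm
        simp [hmj]
      · have h1 : i < m := lt_of_le_of_lt hi (not_le.1 hm)
        simp [hm, h1.ne]
  · rw [Finset.sum_eq_single i (fun m _ hm => by simp [leadBlock, hi, hm.symm]) (by simp)]
    simp [leadBlock, hi]

lemma topRows_mul (k : Fin n) {L : Mat n} (b : Mat n) (hL : ∀ i j : Fin n, i < j → L i j = 0) :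
    topRows k (L * b) = leadBlock k L * topRows k b := by
  ext i j
  rw [mul_apply]
  by_cases hi : i ≤ k
  · simp only [leadBlock, topRows, of_apply, hi, if_true, true_and, mul_apply]
    refine Finset.sum_congr rfl fun m _ => ?_
    by_cases hm : m ≤ k
    · simp [hm]
    · have h1 : i < m := lt_of_le_of_lt hi (not_le.1 hm)
      simp [hm, hL i m h1]
  · rw [Finset.sum_eq_single i (fun m _ hm => by simp [leadBlock, hi, hm.symm]) (by simp)]
    simp [topRows, hi]

lemma upperUni.blockTriangular {x : Mat n} (hx : upperUni x) : x.BlockTriangular id :=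
  fun i j h => hx.2 i j h

lemma lowerTriInv.blockTriangular {x : Mat n} (hx : lowerTriInv x) :
    x.BlockTriangular OrderDual.toDual :=
  fun i j h => hx.2 i j h

lemma upperUni.det {x : Mat n} (hx : upperUni x) : x.det = 1 := by
  rw [det_of_isUpperTriangular hx.blockTriangular]
  simp [hx.1]

lemma lowerUni.det {x : Mat n} (hx : lowerUni x) : x.det = 1 := by
  rw [det_of_isLowerTriangular x (fun i j h => hx.2 i j h)]
  simp [hx.1]

lemma lowerTriInv.diag_ne_zero {x : Mat n} (hx : lowerTriInv x) (i : Fin n) : x i i ≠ 0 := by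
  have h := hx.1.ne_zero
  rw [det_of_isLowerTriangular x (fun i j h => hx.2 i j h), Finset.prod_ne_zero_iff] at h
  exact h i (Finset.mem_univ i)

lemma lowerUni.lowerTriInv {x : Mat n} (hx : lowerUni x) : lowerTriInv x :=
  ⟨by rw [hx.det]; exact isUnit_one, hx.2⟩

lemma lowerTriInv_of_diag {x : Mat n} (h : ∀ i j : Fin n, i < j → x i j = 0)
    (hd : ∀ i, x i i ≠ 0) : lowerTriInv x := by
  refine ⟨?_, h⟩
  rw [det_of_isLowerTriangular x (fun i j h' => h i j h'), isUnit_iff_ne_zero,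
    Finset.prod_ne_zero_iff]
  exact fun i _ => hd i

lemma diagInv.lowerTriInv {x : Mat n} (hx : diagInv x) : lowerTriInv x :=
  ⟨hx.1, fun i j h => hx.2 i j h.ne⟩

lemma lowerTriInv.mul {x y : Mat n} (hx : lowerTriInv x) (hy : lowerTriInv y) :
    lowerTriInv (x * y) :=
  ⟨by rw [det_mul]; exact hx.1.mul hy.1,
    fun i j h => (hx.blockTriangular.mul hy.blockTriangular) h⟩

lemma blockTriangular_inv {α : Type*} [LinearOrder α] {f : Fin n → α} {x : Mat n}
    (hx : IsUnit x.det) (h : x.BlockTriangular f) : (x⁻¹).BlockTriangular f := by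
  have := x.invertibleOfIsUnitDet hx
  exact blockTriangular_inv_of_blockTriangular h

lemma lowerTriInv.inv {x : Mat n} (hx : lowerTriInv x) : lowerTriInv x⁻¹ :=
  ⟨isUnit_nonsing_inv_det x hx.1, fun _ _ h => blockTriangular_inv hx.1 hx.blockTriangular h⟩

lemma BlockTriangular.mul_apply_self {α : Type*} [LinearOrder α] {f : Fin n → α}
    (hf : Function.Injective f) {x y : Mat n} (hx : x.BlockTriangular f)
    (hy : y.BlockTriangular f) (i : Fin n) : (x * y) i i = x i i * y i i := by
  rw [mul_apply]
  refine Finset.sum_eq_single i (fun j _ hj => ?_) (by simp)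
  rcases lt_or_gt_of_ne (hf.ne hj) with h | h
  · rw [hx h, zero_mul]
  · rw [hy h, mul_zero]

lemma upperUni.mul {x y : Mat n} (hx : upperUni x) (hy : upperUni y) : upperUni (x * y) := by
  refine ⟨fun i => ?_, fun i j h => (hx.blockTriangular.mul hy.blockTriangular) h⟩
  rw [BlockTriangular.mul_apply_self Function.injective_id hx.blockTriangular hy.blockTriangular,
    hx.1, hy.1, one_mul]

lemma upperUni.isUnit {x : Mat n} (hx : upperUni x) : IsUnit x.det := by
  rw [hx.det]; exact isUnit_one

lemma upperUni.inv {x : Mat n} (hx : upperUni x) : upperUni x⁻¹ := by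
  have h := blockTriangular_inv hx.isUnit hx.blockTriangular
  refine ⟨fun i => ?_, fun i j hij => h hij⟩
  have h1 := BlockTriangular.mul_apply_self Function.injective_id hx.blockTriangular h i
  rw [mul_nonsing_inv _ hx.isUnit, one_apply_eq, hx.1, one_mul] at h1
  exact h1.symm

lemma upperUni_one : upperUni (1 : Mat n) :=
  ⟨fun i => one_apply_eq i, fun _ _ h => one_apply_ne h.ne'⟩

lemma lowerTriInv_one : lowerTriInv (1 : Mat n) :=
  ⟨by simp, fun _ _ h => one_apply_ne h.ne⟩

lemma hasGauss_of_mul {L b : Mat n} (hL : lowerTriInv L) (hb : upperUni b) :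
    hasGauss (L * b) := by
  refine ⟨L * diagonal fun i => (L i i)⁻¹, diagonal fun i => L i i, b, ⟨fun i => ?_,
    fun i j h => ?_⟩, ⟨?_, fun i j h => diagonal_apply_ne _ h⟩, hb, ?_⟩
  · rw [mul_diagonal, mul_inv_cancel₀ (hL.diag_ne_zero i)]
  · rw [mul_diagonal, hL.2 i j h, zero_mul]
  · rw [det_diagonal, isUnit_iff_ne_zero, Finset.prod_ne_zero_iff]
    exact fun i _ => hL.diag_ne_zero i
  · rw [Matrix.mul_assoc L, diagonal_mul_diagonal]
    congr 1
    rw [show (fun i => (L i i)⁻¹ * L i i) = fun _ => (1 : ℝ) from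
      funext fun i => inv_mul_cancel₀ (hL.diag_ne_zero i), diagonal_one, Matrix.mul_one]

lemma hasGauss.spec {M : Mat n} (h : hasGauss M) :
    lowerUni (gaussMinus M) ∧ diagInv (gaussDiag M) ∧ upperUni (gaussPlus M) ∧
      M = gaussMinus M * gaussDiag M * gaussPlus M := by
  unfold gaussMinus gaussDiag gaussPlus
  simp only [h, dif_pos]
  exact h.choose_spec.choose_spec.choose_spec

lemma leadBlock_det_ne_zero_of_lower (k : Fin n) {L : Mat n} (hL : lowerTriInv L) :
    (leadBlock k L).det ≠ 0 := by
  refine (lowerTriInv_of_diag (fun i j h => ?_) fun i => ?_).1.ne_zero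
  · simp only [leadBlock, of_apply, hL.2 i j h, h.ne]; simp
  · simp only [leadBlock, of_apply, and_self, if_true]
    split_ifs
    · exact hL.diag_ne_zero i
    · exact one_ne_zero

lemma leadBlock_det_of_upper (k : Fin n) {b : Mat n} (hb : upperUni b) :
    (leadBlock k b).det = 1 := by
  refine upperUni.det ⟨fun i => ?_, fun i j h => ?_⟩
  · simp [leadBlock, hb.1]
  · simp only [leadBlock, of_apply, hb.2 i j h, h.ne']; simp

lemma leadBlock_det_ne_zero (k : Fin n) {L b : Mat n} (hL : lowerTriInv L) (hb : upperUni b) :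
    (leadBlock k (L * b)).det ≠ 0 := by
  rw [leadBlock_mul k hL.2, det_mul, leadBlock_det_of_upper k hb, mul_one]
  exact leadBlock_det_ne_zero_of_lower k hL

lemma plusFormula_mul {L b : Mat n} (hL : lowerTriInv L) (hb : upperUni b) :
    plusFormula (L * b) = b := by
  ext k l
  have hW : leadBlock k b * ((leadBlock k (L * b))⁻¹ * topRows k (L * b)) = topRows k b := by
    have h1 : IsUnit (leadBlock k L).det := (leadBlock_det_ne_zero_of_lower k hL).isUnit
    have h2 : IsUnit (leadBlock k b).det := by rw [leadBlock_det_of_upper k hb]; exact isUnit_one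
    rw [topRows_mul k b hL.2, leadBlock_mul k hL.2, Matrix.mul_inv_rev, ← Matrix.mul_assoc,
      ← Matrix.mul_assoc, ← Matrix.mul_assoc, mul_nonsing_inv _ h2, Matrix.one_mul,
      nonsing_inv_mul _ h1, Matrix.one_mul]
  have hW' := congrFun (congrFun hW k) l
  rw [mul_apply, Finset.sum_eq_single k] at hW'
  · simpa [leadBlock, topRows, hb.1, plusFormula] using hW'
  · intro j _ hj
    have : leadBlock k b k j = 0 := by
      simp only [leadBlock, of_apply, hj.symm, if_false, le_refl, true_and]
      split_ifs with h
      · exact hb.2 k j (lt_of_le_of_ne h hj)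
      · rfl
    rw [this, zero_mul]
  · simp

lemma gaussPlus_mul {L b : Mat n} (hL : lowerTriInv L) (hb : upperUni b) :
    gaussPlus (L * b) = b := by
  obtain ⟨h1, h2, h3, h4⟩ := (hasGauss_of_mul hL hb).spec
  rw [← plusFormula_mul (h1.lowerTriInv.mul h2.lowerTriInv) h3, ← h4, plusFormula_mul hL hb]

lemma hasGauss.exists_mul {M : Mat n} (h : hasGauss M) :
    ∃ L, lowerTriInv L ∧ upperUni (gaussPlus M) ∧ M = L * gaussPlus M :=
  ⟨_, h.spec.1.lowerTriInv.mul h.spec.2.1.lowerTriInv, h.spec.2.2.1, h.spec.2.2.2⟩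

lemma hasGauss.gaussPlus_eq {M : Mat n} (h : hasGauss M) : gaussPlus M = plusFormula M := by
  obtain ⟨L, hL, hb, e⟩ := h.exists_mul
  conv_rhs => rw [e, plusFormula_mul hL hb]

lemma hasGauss.leadBlock_det_ne_zero {M : Mat n} (h : hasGauss M) (k : Fin n) :
    (leadBlock k M).det ≠ 0 := by
  obtain ⟨L, hL, hb, e⟩ := h.exists_mul
  rw [e]
  exact BruhatTNN.leadBlock_det_ne_zero k hL hb

lemma gaussMinus_mul {a b : Mat n} (ha : lowerUni a) (hb : upperUni b) :
    gaussMinus (a * b) = a := by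
  obtain ⟨h1, h2, h3, h4⟩ := (hasGauss_of_mul ha.lowerTriInv hb).spec
  rw [gaussPlus_mul ha.lowerTriInv hb] at h4
  have h5 : a = gaussMinus (a * b) * gaussDiag (a * b) := by
    have := congrArg (· * b⁻¹) h4
    simpa only [Matrix.mul_assoc, mul_nonsing_inv _ hb.isUnit, Matrix.mul_one] using this
  have hd : ∀ i j, a i j = gaussMinus (a * b) i j * gaussDiag (a * b) j j := by
    intro i j
    conv_lhs => rw [h5, mul_apply]
    exact Finset.sum_eq_single j (fun m _ hm => by rw [h2.2 m j hm, mul_zero]) (by simp)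
  ext i j
  have := hd j j
  rw [ha.1, h1.1, one_mul] at this
  rw [hd i j, ← this, mul_one]

/-- The coefficients expressing the rows of `plusFormula M` through those of `M`. -/
noncomputable def lowerFormula (M : Mat n) : Mat n :=
  of fun k l => if l ≤ k then (leadBlock k M)⁻¹ k l else 0

lemma lowerFormula_mul (M : Mat n) : lowerFormula M * M = plusFormula M := by
  ext k l
  simp only [lowerFormula, plusFormula, of_apply, mul_apply, topRows]
  refine Finset.sum_congr rfl fun m _ => ?_
  split_ifs <;> simp

lemma plusFormula_upperUni {M : Mat n} (h : ∀ k, (leadBlock k M).det ≠ 0) :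
    upperUni (plusFormula M) := by
  have key : ∀ k l : Fin n, l ≤ k → plusFormula M k l = (1 : Mat n) k l := by
    intro k l hl
    have h1 : ((leadBlock k M)⁻¹ * leadBlock k M) k l = (1 : Mat n) k l := by
      rw [nonsing_inv_mul _ (h k).isUnit]
    rw [← h1]
    simp only [plusFormula, of_apply, mul_apply, topRows, leadBlock, hl, and_true]
    refine Finset.sum_congr rfl fun m _ => ?_
    split_ifs with h2 h3
    · rfl
    · exact absurd (h3 ▸ hl) h2
    · rfl
  exact ⟨fun i => by rw [key i i le_rfl, one_apply_eq],
    fun i j h => by rw [key i j h.le, one_apply_ne h.ne']⟩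

lemma exists_mul_of_leadBlock {M : Mat n} (h : ∀ k, (leadBlock k M).det ≠ 0) :
    lowerTriInv (lowerFormula M) ∧ upperUni (plusFormula M) ∧
      M = (lowerFormula M)⁻¹ * plusFormula M := by
  have hb := plusFormula_upperUni h
  have hdet := congrArg det (lowerFormula_mul M)
  rw [det_mul, hb.det] at hdet
  have hC : IsUnit (lowerFormula M).det := IsUnit.of_mul_eq_one _ hdet
  refine ⟨⟨hC, fun i j hij => ?_⟩, hb, ?_⟩
  · simp [lowerFormula, not_le.2 hij]
  · rw [← lowerFormula_mul M, ← Matrix.mul_assoc, nonsing_inv_mul _ hC, Matrix.one_mul]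

lemma hasGauss_of_leadBlock {M : Mat n} (h : ∀ k, (leadBlock k M).det ≠ 0) : hasGauss M := by
  obtain ⟨h1, h2, h3⟩ := exists_mul_of_leadBlock h
  rw [h3]
  exact hasGauss_of_mul h1.inv h2

lemma BlockTriangular.det_ne_zero {α : Type*} [LinearOrder α] {f : Fin n → α}
    (hf : Function.Injective f) {x : Mat n} (hx : x.BlockTriangular f) (hd : ∀ i, x i i ≠ 0) :
    x.det ≠ 0 := by
  rw [Matrix.BlockTriangular.det hx, Finset.prod_ne_zero_iff]
  intro a ha
  obtain ⟨i, -, rfl⟩ := Finset.mem_image.1 ha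
  have : Subsingleton {j // f j = f i} := ⟨fun p q => Subtype.ext (hf (p.2.trans q.2.symm))⟩
  rw [det_eq_elem_of_subsingleton _ (⟨i, rfl⟩ : {j // f j = f i})]
  exact hd i

/-- A matrix triangular for another linear order of the indices has a Gaussian decomposition,
and its factors are triangular for that order as well. -/
lemma BlockTriangular.exists_gauss {α : Type*} [LinearOrder α] {f : Fin n → α}
    (hf : Function.Injective f) {M : Mat n} (hM : M.BlockTriangular f) (hd : ∀ i, M i i ≠ 0) :
    ∃ L b : Mat n, lowerTriInv L ∧ upperUni b ∧ L.BlockTriangular f ∧ b.BlockTriangular f ∧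
      M = L * b ∧ ∀ i, L i i = M i i := by
  have hlb : ∀ k, (leadBlock k M).BlockTriangular f := by
    intro k i j hij
    have : i ≠ j := by rintro rfl; exact lt_irrefl _ hij
    simp [leadBlock, hM hij, this]
  have hdet : ∀ k, (leadBlock k M).det ≠ 0 := by
    intro k
    refine BlockTriangular.det_ne_zero hf (hlb k) fun i => ?_
    simp only [leadBlock, of_apply, and_self, if_true]
    split_ifs
    · exact hd i
    · exact one_ne_zero
  obtain ⟨h1, h2, h3⟩ := exists_mul_of_leadBlock hdet
  have hC : (lowerFormula M).BlockTriangular f := by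
    intro i j hij
    simp only [lowerFormula, of_apply]
    split_ifs
    · exact blockTriangular_inv (hdet i).isUnit (hlb i) hij
    · rfl
  have hb : (plusFormula M).BlockTriangular f := by
    rw [← lowerFormula_mul]
    exact hC.mul hM
  have hL := blockTriangular_inv h1.1 hC
  refine ⟨_, _, h1.inv, h2, hL, hb, h3, fun i => ?_⟩
  conv_rhs => rw [h3, BlockTriangular.mul_apply_self hf hL hb, h2.1, mul_one]

lemma continuous_leadBlock (k : Fin n) : Continuous fun M : Mat n => leadBlock k M := by
  refine continuous_matrix fun i j => ?_
  simp only [leadBlock, of_apply]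
  split_ifs
  · exact continuous_id.matrix_elem i j
  · exact continuous_const
  · exact continuous_const

lemma continuousOn_gaussPlus : ContinuousOn (gaussPlus : Mat n → Mat n) {M | hasGauss M} := by
  have h : ContinuousOn (plusFormula : Mat n → Mat n) {M | hasGauss M} := by
    refine continuousOn_pi.2 fun k => continuousOn_pi.2 fun l => ?_
    have he : ∀ M : Mat n, plusFormula M k l =
        (leadBlock k M).det⁻¹ * ((leadBlock k M).adjugate * topRows k M) k l := by
      intro M
      simp [plusFormula, Matrix.inv_def]
    simp only [he]
    have ht : Continuous fun M : Mat n => topRows k M := by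
      refine continuous_matrix fun i j => ?_
      simp only [topRows, of_apply]
      split_ifs
      · exact continuous_id.matrix_elem i j
      · exact continuous_const
    refine ContinuousOn.mul (ContinuousOn.inv₀ (continuous_leadBlock k).matrix_det.continuousOn
      fun M hM => hasGauss.leadBlock_det_ne_zero hM k) (Continuous.continuousOn ?_)
    exact ((continuous_leadBlock k).matrix_adjugate.matrix_mul ht).matrix_elem k l
  exact h.congr fun M hM => hasGauss.gaussPlus_eq hM

end Gauss

section Cells

variable {n : ℕ}

open Matrix

lemma permMat_mul_apply (u : Equiv.Perm (Fin n)) (M : Mat n) (i j : Fin n) :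
    (permMat u * M) i j = M (u⁻¹ i) j := by
  rw [mul_apply, Finset.sum_eq_single (u⁻¹ i)]
  · simp [permMat]
  · intro m _ hm
    have : i ≠ u m := by rintro rfl; simp at hm
    simp [permMat, this]
  · simp

lemma mul_permMat_apply (u : Equiv.Perm (Fin n)) (M : Mat n) (i j : Fin n) :
    (M * permMat u) i j = M i (u j) := by
  rw [mul_apply, Finset.sum_eq_single (u j)]
  · simp [permMat]
  · intro m _ hm
    simp [permMat, hm]
  · simp

lemma permMat_mul (u v : Equiv.Perm (Fin n)) : permMat u * permMat v = permMat (u * v) := by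
  ext i j
  rw [mul_permMat_apply]
  simp only [permMat, of_apply, Equiv.Perm.mul_apply]
  congr

lemma permMat_one : permMat (1 : Equiv.Perm (Fin n)) = 1 := by
  ext i j
  by_cases h : i = j <;> simp [permMat, one_apply, h]

lemma permMat_inv_mul (u : Equiv.Perm (Fin n)) : permMat u⁻¹ * permMat u = 1 := by
  rw [permMat_mul, inv_mul_cancel, permMat_one]

lemma permMat_mul_inv (u : Equiv.Perm (Fin n)) : permMat u * permMat u⁻¹ = 1 := by
  rw [permMat_mul, mul_inv_cancel, permMat_one]

lemma permMat_conj_apply (u : Equiv.Perm (Fin n)) (y : Mat n) (i j : Fin n) :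
    (permMat u⁻¹ * y * permMat u) i j = y (u i) (u j) := by
  rw [mul_permMat_apply, permMat_mul_apply, inv_inv]

lemma permMat_conj_apply' (u : Equiv.Perm (Fin n)) (y : Mat n) (i j : Fin n) :
    (permMat u * y * permMat u⁻¹) i j = y (u⁻¹ i) (u⁻¹ j) := by
  rw [mul_permMat_apply, permMat_mul_apply]

lemma upperUni.conj {u : Equiv.Perm (Fin n)} {y : Mat n} (hy : upperUni y) :
    (∀ i, (permMat u⁻¹ * y * permMat u) i i = 1) ∧
      (permMat u⁻¹ * y * permMat u).BlockTriangular u :=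
  ⟨fun i => by rw [permMat_conj_apply, hy.1],
    fun i j h => by rw [permMat_conj_apply]; exact hy.2 _ _ h⟩

lemma upperUni_conj {u : Equiv.Perm (Fin n)} {c : Mat n} (hd : ∀ i, c i i = 1)
    (hc : c.BlockTriangular u) : upperUni (permMat u * c * permMat u⁻¹) :=
  ⟨fun i => by rw [permMat_conj_apply', hd],
    fun i j h => by rw [permMat_conj_apply']; exact hc (by simpa using h)⟩

lemma conj_conj (u : Equiv.Perm (Fin n)) (c : Mat n) :
    permMat u⁻¹ * (permMat u * c * permMat u⁻¹) * permMat u = c := by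
  ext i j
  rw [permMat_conj_apply, permMat_conj_apply']
  simp

lemma mem_Ngrp_iff {u : Equiv.Perm (Fin n)} {x : Mat n} :
    x ∈ Ngrp u ↔ upperUni x ∧ x.BlockTriangular u := by
  constructor
  · rintro ⟨hx, y, hy, rfl⟩
    exact ⟨hx, hy.conj.2⟩
  · rintro ⟨hx, h⟩
    exact ⟨hx, _, upperUni_conj hx.1 h, (conj_conj u x).symm⟩

/-- Every element of `B_- u B_-` is of the form `b u c` with `b ∈ B_-` and
`c ∈ u⁻¹ N u ∩ N_-`. -/
lemma exists_normal_form {u : Equiv.Perm (Fin n)} {z : Mat n} (hz : z ∈ doubleCosetBm u) :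
    ∃ b c : Mat n, lowerTriInv b ∧ lowerUni c ∧ c.BlockTriangular u ∧ z = b * permMat u * c := by
  obtain ⟨b₁, b₂, h₁, h₂, rfl⟩ := hz
  have hinj : Function.Injective fun i => OrderDual.toDual (u⁻¹ i) :=
    OrderDual.toDual.injective.comp u⁻¹.injective
  have hM : (permMat u * b₂ * permMat u⁻¹).BlockTriangular
      fun i => OrderDual.toDual (u⁻¹ i) := by
    intro i j h
    rw [permMat_conj_apply']
    exact h₂.2 _ _ h
  obtain ⟨L, b, hL, hb, -, hbf, e, -⟩ := BlockTriangular.exists_gauss hinj hM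
    fun i => by rw [permMat_conj_apply']; exact h₂.diag_ne_zero _
  refine ⟨b₁ * L, permMat u⁻¹ * b * permMat u, h₁.mul hL, ⟨hb.conj.1, fun i j h => ?_⟩,
    hb.conj.2, ?_⟩
  · rw [permMat_conj_apply]
    exact hbf (by simpa using h)
  · have : b₂ = permMat u⁻¹ * (L * b) * permMat u := by rw [← e, conj_conj]
    rw [this]
    simp only [Matrix.mul_assoc]
    rw [← Matrix.mul_assoc (permMat u) (permMat u⁻¹), permMat_mul_inv, Matrix.one_mul,
      ← Matrix.mul_assoc (permMat u) (permMat u⁻¹), permMat_mul_inv, Matrix.one_mul]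

/-- The data `x = L u A_- A_+` from which all the Gaussian factors in the statement are read
off. -/
structure IsFactorization (u : Equiv.Perm (Fin n)) (x L Am Ap : Mat n) : Prop where
  lower : lowerTriInv L
  minus : lowerUni Am
  minus_tri : Am.BlockTriangular u
  plus : upperUni Ap
  plus_tri : Ap.BlockTriangular u
  eq : x = L * permMat u * Am * Ap

namespace IsFactorization

variable {u : Equiv.Perm (Fin n)} {x L Am Ap : Mat n}

lemma upperUni_conj_mul (h : IsFactorization u x L Am Ap) :
    upperUni (permMat u * (Am * Ap) * permMat u⁻¹) := by
  refine upperUni_conj (fun i => ?_) (h.minus_tri.mul h.plus_tri)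
  rw [BlockTriangular.mul_apply_self u.injective h.minus_tri h.plus_tri, h.minus.1, h.plus.1,
    one_mul]

lemma mul_perm (h : IsFactorization u x L Am Ap) :
    x * permMat u⁻¹ = L * (permMat u * (Am * Ap) * permMat u⁻¹) := by
  rw [h.eq]
  simp only [Matrix.mul_assoc]

lemma hasGauss (h : IsFactorization u x L Am Ap) : hasGauss (x * permMat u⁻¹) := by
  rw [h.mul_perm]
  exact hasGauss_of_mul h.lower h.upperUni_conj_mul

lemma Amat_eq (h : IsFactorization u x L Am Ap) : Amat u x = Am * Ap := by
  rw [Amat, h.mul_perm, gaussPlus_mul h.lower h.upperUni_conj_mul, conj_conj]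

lemma hasGauss_Amat (h : IsFactorization u x L Am Ap) : BruhatTNN.hasGauss (Amat u x) := by
  rw [h.Amat_eq]
  exact hasGauss_of_mul h.minus.lowerTriInv h.plus

lemma gaussPlus_Amat (h : IsFactorization u x L Am Ap) : gaussPlus (Amat u x) = Ap := by
  rw [h.Amat_eq, gaussPlus_mul h.minus.lowerTriInv h.plus]

lemma gaussMinus_Amat (h : IsFactorization u x L Am Ap) : gaussMinus (Amat u x) = Am := by
  rw [h.Amat_eq, gaussMinus_mul h.minus h.plus]

lemma perm_mul_minus (h : IsFactorization u x L Am Ap) : permMat u * Am = L⁻¹ * (x * Ap⁻¹) := by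
  rw [h.eq]
  simp only [Matrix.mul_assoc]
  rw [mul_nonsing_inv _ h.plus.isUnit, Matrix.mul_one, ← Matrix.mul_assoc L⁻¹,
    nonsing_inv_mul _ h.lower.1, Matrix.one_mul]

lemma hasGauss_perm_mul (h : IsFactorization u x L Am Ap) (hx : upperUni x) :
    BruhatTNN.hasGauss (permMat u * gaussMinus (Amat u x)) := by
  rw [h.gaussMinus_Amat, h.perm_mul_minus]
  exact hasGauss_of_mul h.lower.inv (hx.mul h.plus.inv)

lemma piMap_eq (h : IsFactorization u x L Am Ap) (hx : upperUni x) :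
    piMap u x = x * Ap⁻¹ := by
  rw [piMap, h.gaussMinus_Amat, h.perm_mul_minus, gaussPlus_mul h.lower.inv (hx.mul h.plus.inv)]

lemma piMap_mem (h : IsFactorization u x L Am Ap) (hx : upperUni x) : piMap u x ∈ Ncell u := by
  rw [h.piMap_eq hx]
  refine ⟨hx.mul h.plus.inv, L, Am, h.lower, h.minus.lowerTriInv, ?_⟩
  rw [h.eq, Matrix.mul_assoc _ Ap, mul_nonsing_inv _ h.plus.isUnit, Matrix.mul_one]

lemma eq_piMap_mul (h : IsFactorization u x L Am Ap) (hx : upperUni x) :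
    x = piMap u x * Ap := by
  rw [h.piMap_eq hx, Matrix.mul_assoc, nonsing_inv_mul _ h.plus.isUnit, Matrix.mul_one]

end IsFactorization

lemma exists_isFactorization {u : Equiv.Perm (Fin n)} {x : Mat n}
    (h : hasGauss (x * permMat u⁻¹)) : ∃ L Am Ap, IsFactorization u x L Am Ap := by
  obtain ⟨L, hL, hy, e⟩ := h.exists_mul
  set y := gaussPlus (x * permMat u⁻¹)
  have hA := hy.conj (u := u)
  obtain ⟨Am, Ap, h1, h2, h3, h4, h5, h6⟩ := BlockTriangular.exists_gauss u.injective hA.2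
    fun i => by rw [hA.1]; exact one_ne_zero
  refine ⟨L, Am, Ap, hL, ⟨fun i => by rw [h6, hA.1], h1.2⟩, h3, h2, h4, ?_⟩
  have hx : x = x * permMat u⁻¹ * permMat u := by
    rw [Matrix.mul_assoc, permMat_inv_mul, Matrix.mul_one]
  rw [hx, e, Matrix.mul_assoc _ Am, ← h5]
  simp only [Matrix.mul_assoc]
  rw [← Matrix.mul_assoc (permMat u), permMat_mul_inv, Matrix.one_mul]

lemma exists_isFactorization_of_mem {u : Equiv.Perm (Fin n)} {xu xp : Mat n}
    (hxu : xu ∈ Ncell u) (hxp : xp ∈ Ngrp u) :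
    ∃ L Am, IsFactorization u (xu * xp) L Am xp := by
  obtain ⟨b, c, hb, hc, hcu, e⟩ := exists_normal_form hxu.2
  rw [mem_Ngrp_iff] at hxp
  exact ⟨b, c, hb, hc, hcu, hxp.1, hxp.2, by rw [e]⟩

lemma one_mem_Ngrp (u : Equiv.Perm (Fin n)) : (1 : Mat n) ∈ Ngrp u :=
  mem_Ngrp_iff.2 ⟨upperUni_one, blockTriangular_one⟩

lemma exists_isFactorization_of_mem_Ncell {u : Equiv.Perm (Fin n)} {z : Mat n}
    (hz : z ∈ Ncell u) : ∃ L Am, IsFactorization u z L Am 1 := by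
  simpa using exists_isFactorization_of_mem hz (one_mem_Ngrp u)

lemma hasGauss_of_mem_Ncell {u : Equiv.Perm (Fin n)} {z : Mat n} (hz : z ∈ Ncell u) :
    hasGauss (z * permMat u⁻¹) := by
  obtain ⟨L, Am, h⟩ := exists_isFactorization_of_mem_Ncell hz
  exact h.hasGauss

lemma piMap_of_mem_Ncell {u : Equiv.Perm (Fin n)} {z : Mat n} (hz : z ∈ Ncell u) :
    piMap u z = z := by
  obtain ⟨L, Am, h⟩ := exists_isFactorization_of_mem_Ncell hz
  rw [h.piMap_eq hz.1, inv_one, Matrix.mul_one]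

lemma continuousOn_Amat (u : Equiv.Perm (Fin n)) :
    ContinuousOn (Amat u) {x | hasGauss (x * permMat u⁻¹)} := by
  have h : ContinuousOn (fun x : Mat n => gaussPlus (x * permMat u⁻¹))
      {x | hasGauss (x * permMat u⁻¹)} :=
    continuousOn_gaussPlus.comp (continuous_id.matrix_mul continuous_const).continuousOn
      fun x hx => hx
  exact ((continuous_const.matrix_mul continuous_id).matrix_mul
    continuous_const).comp_continuousOn h

lemma continuousOn_piMap (u : Equiv.Perm (Fin n)) :
    ContinuousOn (piMap u) {x | upperUni x ∧ hasGauss (x * permMat u⁻¹)} := by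
  have h1 : ContinuousOn (fun x : Mat n => gaussPlus (Amat u x))
      {x | upperUni x ∧ hasGauss (x * permMat u⁻¹)} := by
    refine continuousOn_gaussPlus.comp ((continuousOn_Amat u).mono fun x hx => hx.2) ?_
    rintro x ⟨-, hx⟩
    obtain ⟨L, Am, Ap, h⟩ := exists_isFactorization hx
    exact h.hasGauss_Amat
  have h2 : ContinuousOn (fun x : Mat n => x * (gaussPlus (Amat u x)).adjugate)
      {x | upperUni x ∧ hasGauss (x * permMat u⁻¹)} := by
    have : Continuous fun p : Mat n × Mat n => p.1 * p.2.adjugate :=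
      continuous_fst.matrix_mul continuous_snd.matrix_adjugate
    exact this.comp_continuousOn (continuousOn_id.prodMk h1)
  refine h2.congr ?_
  rintro x ⟨hx, hx'⟩
  obtain ⟨L, Am, Ap, h⟩ := exists_isFactorization hx'
  simp only [h.piMap_eq hx, h.gaussPlus_Amat, Matrix.inv_def, h.plus.det]
  simp

lemma eq_of_permMat_eq_mul {v w : Equiv.Perm (Fin n)} {b₁ b₂ : Mat n} (h₁ : lowerTriInv b₁)
    (h₂ : lowerTriInv b₂) (h : permMat w = b₁ * permMat v * b₂) : w = v := by
  have h' : b₁⁻¹ * permMat w = permMat v * b₂ := by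
    rw [h, Matrix.mul_assoc b₁, ← Matrix.mul_assoc b₁⁻¹, nonsing_inv_mul _ h₁.1, Matrix.one_mul]
  have hle : ∀ j, j ≤ (v⁻¹ * w) j := by
    intro j
    by_contra hj
    have := congrFun (congrFun h' (w j)) j
    rw [mul_permMat_apply, permMat_mul_apply] at this
    exact h₁.inv.diag_ne_zero _ (this.trans (h₂.2 _ _ (not_le.1 hj)))
  have h1 : v⁻¹ * w = 1 := by
    ext j
    by_contra hne
    have hs : ∑ j : Fin n, ((v⁻¹ * w) j : ℕ) = ∑ j : Fin n, (j : ℕ) :=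
      Equiv.sum_comp (v⁻¹ * w) fun j => (j : ℕ)
    refine (Finset.sum_lt_sum (fun j _ => ?_) ⟨j, Finset.mem_univ _, ?_⟩).ne' hs
    · exact hle j
    · exact lt_of_le_of_ne (hle j) fun h => hne h.symm
  rw [inv_mul_eq_one] at h1
  exact h1.symm

/-- The double cosets `B_- w B_-` are pairwise disjoint. -/
lemma doubleCosetBm_disjoint {v w : Equiv.Perm (Fin n)} {x : Mat n} (hv : x ∈ doubleCosetBm v)
    (hw : x ∈ doubleCosetBm w) : w = v := by
  obtain ⟨a₁, a₂, ha₁, ha₂, rfl⟩ := hv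
  obtain ⟨b₁, b₂, hb₁, hb₂, e⟩ := hw
  refine eq_of_permMat_eq_mul (hb₁.inv.mul ha₁) (ha₂.mul hb₂.inv) ?_
  have : b₁⁻¹ * (a₁ * permMat v * a₂) * b₂⁻¹ = permMat w := by
    rw [e, Matrix.mul_assoc b₁, ← Matrix.mul_assoc b₁⁻¹, nonsing_inv_mul _ hb₁.1, Matrix.one_mul,
      Matrix.mul_assoc, mul_nonsing_inv _ hb₂.1, Matrix.mul_one]
  rw [← this]
  simp only [Matrix.mul_assoc]

lemma mul_mem_doubleCosetBm {w : Equiv.Perm (Fin n)} {x b : Mat n} (hx : x ∈ doubleCosetBm w)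
    (hb : lowerTriInv b) : x * b ∈ doubleCosetBm w := by
  obtain ⟨b₁, b₂, h₁, h₂, rfl⟩ := hx
  exact ⟨b₁, b₂ * b, h₁, h₂.mul hb, by rw [Matrix.mul_assoc]⟩

lemma mul_mem_doubleCosetBm' {w : Equiv.Perm (Fin n)} {x b : Mat n} (hx : x ∈ doubleCosetBm w)
    (hb : lowerTriInv b) : b * x ∈ doubleCosetBm w := by
  obtain ⟨b₁, b₂, h₁, h₂, rfl⟩ := hx
  exact ⟨b * b₁, b₂, hb.mul h₁, h₂, by simp only [Matrix.mul_assoc]⟩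

end Cells

section BruhatSteps

variable {n : ℕ} {k k' : Fin n}

open Matrix

lemma mul_transvection_apply (M : Mat n) (t : ℝ) (i j : Fin n) :
    (M * transvection k k' t) i j = if j = k' then M i k' + t * M i k else M i j := by
  split_ifs with h
  · rw [h, mul_transvection_apply_same]
  · rw [mul_transvection_apply_of_ne _ _ _ _ h]

lemma transvection_mul_apply (M : Mat n) (t : ℝ) (i j : Fin n) :
    (transvection k k' t * M) i j = if i = k then M k j + t * M k' j else M i j := by
  split_ifs with h
  · rw [h, transvection_mul_apply_same]
  · rw [transvection_mul_apply_of_ne _ _ _ _ h]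

lemma transvection_apply (t : ℝ) (i j : Fin n) :
    transvection k k' t i j = (1 : Mat n) i j + if i = k ∧ j = k' then t else 0 := by
  rw [transvection, Matrix.add_apply, single_apply]
  simp only [eq_comm]

lemma transvection_upperUni (h : k < k') (t : ℝ) : upperUni (transvection k k' t) := by
  refine ⟨fun i => ?_, fun i j hij => ?_⟩
  · rw [transvection_apply, one_apply_eq, if_neg, add_zero]
    rintro ⟨rfl, rfl⟩
    exact h.false
  · rw [transvection_apply, one_apply_ne hij.ne', if_neg, add_zero]
    rintro ⟨rfl, rfl⟩
    exact h.asymm hij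

lemma transvection_lowerUni (h : k < k') (t : ℝ) : lowerUni (transvection k' k t) := by
  refine ⟨fun i => ?_, fun i j hij => ?_⟩
  · rw [transvection_apply, one_apply_eq, if_neg, add_zero]
    rintro ⟨rfl, rfl⟩
    exact h.false
  · rw [transvection_apply, one_apply_ne hij.ne, if_neg, add_zero]
    rintro ⟨rfl, rfl⟩
    exact h.asymm hij

lemma transvection_neg_mul (h : k ≠ k') (t : ℝ) :
    transvection k k' (-t) * transvection k k' t = 1 := by
  rw [transvection_mul_transvection_same _ _ h, neg_add_cancel, transvection_zero]

lemma transvection_mul_neg (h : k ≠ k') (t : ℝ) :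
    transvection k k' t * transvection k k' (-t) = 1 := by
  rw [transvection_mul_transvection_same _ _ h, add_neg_cancel, transvection_zero]

lemma isUnit_det_permMat (w : Equiv.Perm (Fin n)) : IsUnit (permMat w).det :=
  IsUnit.of_mul_eq_one (permMat w⁻¹).det (by rw [← det_mul, permMat_mul_inv, det_one])

/-- If `w k < w k'`, then conjugating a lower elementary matrix in positions `k, k'` by `w`
gives a lower triangular matrix. -/
lemma lowerTriInv_conj_transvection {w : Equiv.Perm (Fin n)} (h : w k < w k') (t : ℝ) :
    lowerTriInv (permMat w * transvection k' k t * permMat w⁻¹) := by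
  have hk : k' ≠ k := by rintro rfl; exact h.false
  refine ⟨?_, fun i j hij => ?_⟩
  · rw [det_mul, det_mul, det_transvection_of_ne _ _ hk, mul_one]
    exact (isUnit_det_permMat w).mul (isUnit_det_permMat _)
  · rw [permMat_conj_apply', transvection_apply, one_apply_ne (by simpa using hij.ne), if_neg,
      add_zero]
    rintro ⟨hi, hj⟩
    rw [Equiv.Perm.inv_eq_iff_eq] at hi hj
    subst hi hj
    exact h.asymm hij

lemma permMat_mul_transvection (w : Equiv.Perm (Fin n)) (i j : Fin n) (t : ℝ) :
    permMat w * transvection i j t =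
      permMat w * transvection i j t * permMat w⁻¹ * permMat w := by
  rw [Matrix.mul_assoc _ (permMat w⁻¹), permMat_inv_mul, Matrix.mul_one]

lemma swap_apply_lt (hk : (k : ℕ) + 1 = k') {i j : Fin n} (hij : i < j)
    (hne : ¬(i = k ∧ j = k')) : Equiv.swap k k' i < Equiv.swap k k' j := by
  rw [Equiv.swap_apply_def, Equiv.swap_apply_def]
  simp only [Fin.ext_iff, Fin.lt_def] at *
  split_ifs <;> omega

lemma permMat_mul_mem_of_eq_zero (hk : (k : ℕ) + 1 = k') (w : Equiv.Perm (Fin n)) {b : Mat n}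
    (hb : lowerTriInv b) {t : ℝ} (h0 : b k' k * t + b k' k' = 0) :
    permMat w * b * transvection k k' t ∈ doubleCosetBm (w * Equiv.swap k k') := by
  have hlt : k < k' := by rw [Fin.lt_def]; omega
  refine ⟨1, permMat (Equiv.swap k k') * (b * transvection k k' t), lowerTriInv_one,
    ⟨?_, fun i j hij => ?_⟩, ?_⟩
  · rw [det_mul, det_mul, det_transvection_of_ne _ _ hlt.ne, mul_one]
    exact (isUnit_det_permMat _).mul hb.1
  · rw [permMat_mul_apply, Equiv.swap_inv, mul_transvection_apply]
    split_ifs with hj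
    · subst hj
      rcases eq_or_ne i k with rfl | hi
      · rw [Equiv.swap_apply_left]
        linarith
      · have hi' : i < k := by rw [Fin.lt_def] at *; rw [ne_eq, Fin.ext_iff] at hi; omega
        rw [Equiv.swap_apply_of_ne_of_ne hi hij.ne, hb.2 _ _ hij, hb.2 _ _ hi']
        ring
    · refine hb.2 _ _ ?_
      rw [Equiv.swap_apply_def]
      simp only [Fin.ext_iff, Fin.lt_def] at *
      split_ifs <;> omega
  · rw [Matrix.one_mul, ← permMat_mul]
    simp only [Matrix.mul_assoc]
    rw [← Matrix.mul_assoc (permMat (Equiv.swap k k')) (permMat (Equiv.swap k k')), permMat_mul,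
      Equiv.swap_mul_self, permMat_one, Matrix.one_mul]

lemma exists_lower_mul_transvection (hk : (k : ℕ) + 1 = k') {b : Mat n} (hb : lowerTriInv b)
    {t : ℝ} (h0 : b k' k * t + b k' k' ≠ 0) :
    ∃ t' b', (t ≠ 0 → t' ≠ 0) ∧ lowerTriInv b' ∧
      b * transvection k k' t = transvection k k' t' * b' := by
  have hlt : k < k' := by rw [Fin.lt_def]; omega
  set t' := b k k * t / (b k' k * t + b k' k')
  refine ⟨t', transvection k k' (-t') * (b * transvection k k' t), fun ht => ?_,
    ⟨?_, fun i j hij => ?_⟩, ?_⟩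
  · exact div_ne_zero (mul_ne_zero (hb.diag_ne_zero k) ht) h0
  · rw [det_mul, det_mul, det_transvection_of_ne _ _ hlt.ne, det_transvection_of_ne _ _ hlt.ne,
      mul_one, one_mul]
    exact hb.1
  · rw [transvection_mul_apply]
    simp only [mul_transvection_apply]
    split_ifs with hi hj hj
    · subst hi
      have : t' * (b k' i * t + b k' k') = b i i * t := div_mul_cancel₀ _ h0
      rw [hb.2 _ _ hlt]
      linear_combination -this
    · subst hi
      have : k' < j := by
        rw [Fin.lt_def] at *
        rw [Fin.ext_iff] at hj
        omega
      rw [hb.2 _ _ hij, hb.2 _ _ this]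
      ring
    · subst hj
      have : i < k := by
        rw [Fin.lt_def] at *
        rw [Fin.ext_iff] at hi
        omega
      rw [hb.2 _ _ hij, hb.2 _ _ this]
      ring
    · exact hb.2 _ _ hij
  · rw [← Matrix.mul_assoc, transvection_mul_neg hlt.ne, Matrix.one_mul]

lemma permMat_mul_transvection_mem (hk : (k : ℕ) + 1 = k') {w : Equiv.Perm (Fin n)}
    (hw : w k < w k') {t : ℝ} (ht : t ≠ 0) :
    permMat w * transvection k k' t ∈ doubleCosetBm (w * Equiv.swap k k') := by
  have hlt : k < k' := by rw [Fin.lt_def]; omega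
  have h1 := permMat_mul_mem_of_eq_zero hk w (transvection_lowerUni hlt (-t⁻¹)).lowerTriInv
    (t := t) (by simp [transvection_apply, hlt.ne', ht])
  have h2 := mul_mem_doubleCosetBm' h1 (lowerTriInv_conj_transvection hw t⁻¹)
  convert h2 using 1
  rw [← Matrix.mul_assoc, ← Matrix.mul_assoc, ← permMat_mul_transvection,
    Matrix.mul_assoc (permMat w), transvection_mul_neg hlt.ne', Matrix.mul_one]

/-- Multiplication by an elementary matrix in the direction of a descent. -/
lemma mul_transvection_mem_of_descent (hk : (k : ℕ) + 1 = k') {w : Equiv.Perm (Fin n)}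
    (hw : w k' < w k) {b c : Mat n} (hb : lowerTriInv b) (hc : lowerTriInv c) {t : ℝ}
    (h0 : c k' k * t + c k' k' ≠ 0) :
    b * permMat w * c * transvection k k' t ∈ doubleCosetBm w := by
  obtain ⟨t', c', -, hc', e⟩ := exists_lower_mul_transvection hk hc h0
  refine ⟨b * (permMat w * transvection k k' t' * permMat w⁻¹), c',
    hb.mul (lowerTriInv_conj_transvection hw t'), hc', ?_⟩
  rw [Matrix.mul_assoc (b * permMat w), e, Matrix.mul_assoc b _ (permMat w),
    ← permMat_mul_transvection]
  simp only [Matrix.mul_assoc]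

lemma mul_transvection_mem_swap (hk : (k : ℕ) + 1 = k') {w : Equiv.Perm (Fin n)}
    {b c : Mat n} (hb : lowerTriInv b) (hc : lowerTriInv c) {t : ℝ}
    (h0 : c k' k * t + c k' k' = 0) :
    b * permMat w * c * transvection k k' t ∈ doubleCosetBm (w * Equiv.swap k k') := by
  have := mul_mem_doubleCosetBm' (permMat_mul_mem_of_eq_zero hk w hc h0) hb
  simpa only [Matrix.mul_assoc] using this

/-- Multiplication by a nontrivial elementary matrix in the direction of an ascent. -/
lemma mul_transvection_mem_of_ascent (hk : (k : ℕ) + 1 = k') {w : Equiv.Perm (Fin n)}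
    (hw : w k < w k') {z : Mat n} (hz : z ∈ doubleCosetBm w) {t : ℝ} (ht : t ≠ 0) :
    z * transvection k k' t ∈ doubleCosetBm (w * Equiv.swap k k') := by
  obtain ⟨b, c, hb, hc, rfl⟩ := hz
  by_cases h0 : c k' k * t + c k' k' = 0
  · exact mul_transvection_mem_swap hk hb hc h0
  · obtain ⟨t', c', ht', hc', e⟩ := exists_lower_mul_transvection hk hc h0
    have := mul_mem_doubleCosetBm (mul_mem_doubleCosetBm'
      (permMat_mul_transvection_mem hk hw (ht' ht)) hb) hc'
    convert this using 1
    rw [Matrix.mul_assoc (b * permMat w), e]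
    simp only [Matrix.mul_assoc]

lemma mul_transvection_mem_or (hk : (k : ℕ) + 1 = k') {w : Equiv.Perm (Fin n)}
    {z : Mat n} (hz : z ∈ doubleCosetBm w) (t : ℝ) :
    z * transvection k k' t ∈ doubleCosetBm w ∨
      z * transvection k k' t ∈ doubleCosetBm (w * Equiv.swap k k') := by
  have hlt : k < k' := by rw [Fin.lt_def]; omega
  rcases eq_or_ne t 0 with rfl | ht
  · left
    simpa using hz
  rcases lt_or_gt_of_ne (w.injective.ne hlt.ne) with hw | hw
  · exact Or.inr (mul_transvection_mem_of_ascent hk hw hz ht)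
  · obtain ⟨b, c, hb, hc, rfl⟩ := hz
    by_cases h0 : c k' k * t + c k' k' = 0
    · exact Or.inr (mul_transvection_mem_swap hk hb hc h0)
    · exact Or.inl (mul_transvection_mem_of_descent hk hw hb hc h0)

/-- The coordinate along the descent `(k, k')` of an element of `N^u`: removing the factor
`transvection k k' t` with `t = (Amat u z k' k)⁻¹` leads to a smaller cell. -/
lemma mul_transvection_mem_Ncell (hk : (k : ℕ) + 1 = k') {u : Equiv.Perm (Fin n)} {z : Mat n}
    (hz : z ∈ Ncell u) (h : Amat u z k' k ≠ 0) :
    z * transvection k k' (-(Amat u z k' k)⁻¹) ∈ Ncell (u * Equiv.swap k k') := by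
  have hlt : k < k' := by rw [Fin.lt_def]; omega
  obtain ⟨L, Am, hf⟩ := exists_isFactorization_of_mem_Ncell hz
  refine ⟨hz.1.mul (transvection_upperUni hlt _), ?_⟩
  have e := hf.eq
  have hA := hf.Amat_eq
  rw [Matrix.mul_one] at e hA
  rw [hA] at h ⊢
  have h0 : Am k' k * -(Am k' k)⁻¹ + Am k' k' = 0 := by
    rw [hf.minus.1, mul_neg, mul_inv_cancel₀ h, neg_add_cancel]
  have := mul_transvection_mem_swap hk (w := u) hf.lower hf.minus.lowerTriInv h0
  rwa [← e] at this

lemma Amat_mul_transvection (hk : (k : ℕ) + 1 = k') {w : Equiv.Perm (Fin n)} (hw : w k < w k')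
    {z : Mat n} (hz : z ∈ Ncell w) {t : ℝ} (ht : t ≠ 0) :
    z * transvection k k' t ∈ Ncell (w * Equiv.swap k k') ∧
      Amat (w * Equiv.swap k k') (z * transvection k k' t) k' k = t⁻¹ := by
  have hlt : k < k' := by rw [Fin.lt_def]; omega
  have hmem : z * transvection k k' t ∈ Ncell (w * Equiv.swap k k') :=
    ⟨hz.1.mul (transvection_upperUni hlt _), mul_transvection_mem_of_ascent hk hw hz.2 ht⟩
  refine ⟨hmem, ?_⟩
  obtain ⟨L, Am, hf⟩ := exists_isFactorization_of_mem_Ncell hmem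
  have e := hf.eq
  have hA := hf.Amat_eq
  rw [Matrix.mul_one] at e hA
  rw [hA]
  by_contra hne
  have h0 : Am k' k * (-t) + Am k' k' ≠ 0 := by
    rw [hf.minus.1]
    intro h
    refine hne (eq_inv_of_mul_eq_one_left ?_)
    linarith
  have h1 := mul_transvection_mem_of_descent hk (w := w * Equiv.swap k k') (by simpa using hw)
    hf.lower hf.minus.lowerTriInv h0
  rw [← e, Matrix.mul_assoc, transvection_mul_neg hlt.ne, Matrix.mul_one] at h1
  have h2 := doubleCosetBm_disjoint h1 hz.2
  have h3 := congrFun (congrArg DFunLike.coe h2) k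
  simp at h3
  exact hlt.ne h3

end BruhatSteps

section ReducedWords

variable {n : ℕ} {k k' : Fin n}

lemma invNum_mul_swap (hk : (k : ℕ) + 1 = k') {w : Equiv.Perm (Fin n)} (hw : w k < w k') :
    invNum (w * Equiv.swap k k') = invNum w + 1 := by
  have hlt : k < k' := by rw [Fin.lt_def]; omega
  set s := Equiv.swap k k'
  have hs : ∀ i, s (s i) = i := Equiv.swap_apply_self k k'
  have hinj : Function.Injective (Prod.map s s) := s.injective.prodMap s.injective
  have key : (Finset.univ.filter fun p : Fin n × Fin n =>
      p.1 < p.2 ∧ (w * s) p.2 < (w * s) p.1) =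
      insert (k, k') ((Finset.univ.filter fun p : Fin n × Fin n =>
        p.1 < p.2 ∧ w p.2 < w p.1).image (Prod.map s s)) := by
    ext ⟨i, j⟩
    simp only [Finset.mem_filter, Finset.mem_univ, true_and, Finset.mem_insert, Finset.mem_image,
      Prod.exists, Prod.map_apply, Prod.mk.injEq]
    rw [Equiv.Perm.mul_apply, Equiv.Perm.mul_apply]
    constructor
    · rintro ⟨hij, h⟩
      by_cases hne : i = k ∧ j = k'
      · exact Or.inl hne
      · exact Or.inr ⟨s i, s j, ⟨swap_apply_lt hk hij hne, h⟩, hs i, hs j⟩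
    · rintro (⟨rfl, rfl⟩ | ⟨a, b, ⟨hab, h⟩, rfl, rfl⟩)
      · refine ⟨hlt, ?_⟩
        rwa [Equiv.swap_apply_left, Equiv.swap_apply_right]
      · rw [hs, hs]
        refine ⟨swap_apply_lt hk hab ?_, h⟩
        rintro ⟨rfl, rfl⟩
        exact h.asymm hw
  rw [invNum, invNum, key, Finset.card_insert_of_notMem, Finset.card_image_of_injective _ hinj]
  simp only [Finset.mem_filter, Finset.mem_univ, true_and, Finset.mem_image, Prod.exists,
    Prod.map_apply, Prod.mk.injEq, not_exists, not_and]
  rintro a b ⟨hab, -⟩ ha hb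
  have ha' : a = k' := by rw [← hs a, ha, Equiv.swap_apply_left]
  have hb' : b = k := by rw [← hs b, hb, Equiv.swap_apply_right]
  subst ha' hb'
  exact hlt.asymm hab

lemma invNum_mul_swap_le (hk : (k : ℕ) + 1 = k') (w : Equiv.Perm (Fin n)) :
    invNum (w * Equiv.swap k k') ≤ invNum w + 1 := by
  have hlt : k < k' := by rw [Fin.lt_def]; omega
  rcases lt_or_gt_of_ne (w.injective.ne hlt.ne) with hw | hw
  · exact (invNum_mul_swap hk hw).le
  · have h := invNum_mul_swap hk (w := w * Equiv.swap k k') (by simpa using hw)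
    rw [Equiv.mul_swap_mul_self] at h
    omega

lemma invNum_one : invNum (1 : Equiv.Perm (Fin n)) = 0 := by
  rw [invNum, Finset.card_eq_zero, Finset.filter_eq_empty_iff]
  rintro p - ⟨h1, h2⟩
  exact h1.asymm h2

/-- `IsReducedWord u l`: the list `l` of adjacent transpositions, given by pairs `(k, k + 1)` and
read from right to left, is a reduced word of `u`. -/
inductive IsReducedWord : Equiv.Perm (Fin n) → List (Fin n × Fin n) → Prop
  | nil : IsReducedWord 1 []
  | cons {w : Equiv.Perm (Fin n)} {l : List (Fin n × Fin n)} {k k' : Fin n}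
      (h : IsReducedWord w l) (hk : (k : ℕ) + 1 = k') (hw : w k < w k') :
      IsReducedWord (w * Equiv.swap k k') ((k, k') :: l)

lemma IsReducedWord.invNum_eq {u : Equiv.Perm (Fin n)} {l : List (Fin n × Fin n)}
    (h : IsReducedWord u l) : invNum u = l.length := by
  induction h with
  | nil => exact invNum_one
  | cons _ hk hw ih => rw [invNum_mul_swap hk hw, ih, List.length_cons]

lemma eq_one_of_forall_lt {u : Equiv.Perm (Fin n)}
    (h : ∀ k k' : Fin n, (k : ℕ) + 1 = k' → u k < u k') : u = 1 := by
  have key : ∀ (d : ℕ) (i j : Fin n), (i : ℕ) + d + 1 = j → u i < u j := by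
    intro d
    induction d with
    | zero => exact h
    | succ d ih =>
      intro i j hij
      have hj := j.isLt
      exact (ih i ⟨i + d + 1, by omega⟩ rfl).trans (h _ j (by simp only; omega))
  have hmono : StrictMono u := by
    intro i j hij
    rw [Fin.lt_def] at hij
    exact key (j - i - 1) i j (by omega)
  have := Subsingleton.elim (hmono.orderIsoOfSurjective u u.surjective) (OrderIso.refl (Fin n))
  ext i
  exact congrArg Fin.val (DFunLike.congr_fun this i)

lemma exists_isReducedWord (u : Equiv.Perm (Fin n)) : ∃ l, IsReducedWord u l := by
  induction hN : invNum u generalizing u with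
  | zero =>
    have hu : u = 1 := by
      refine eq_one_of_forall_lt fun k k' hk => ?_
      have hlt : k < k' := by rw [Fin.lt_def]; omega
      refine lt_of_not_ge fun hw => ?_
      have := Finset.card_eq_zero.1 hN
      rw [Finset.filter_eq_empty_iff] at this
      exact this (Finset.mem_univ (k, k')) ⟨hlt, hw.lt_of_ne (u.injective.ne hlt.ne')⟩
    exact ⟨[], hu ▸ IsReducedWord.nil⟩
  | succ N ih =>
    have : ∃ k k' : Fin n, (k : ℕ) + 1 = k' ∧ u k' < u k := by
      by_contra! hcon
      have hu : u = 1 := by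
        refine eq_one_of_forall_lt fun k k' hk => ?_
        have hlt : k < k' := by rw [Fin.lt_def]; omega
        exact (hcon k k' hk).lt_of_ne (u.injective.ne hlt.ne)
      rw [hu, invNum_one] at hN
      omega
    obtain ⟨k, k', hk, hw⟩ := this
    have hw' : (u * Equiv.swap k k') k < (u * Equiv.swap k k') k' := by simpa using hw
    have h := invNum_mul_swap hk hw'
    rw [Equiv.mul_swap_mul_self, hN] at h
    obtain ⟨l, hl⟩ := ih (u * Equiv.swap k k') (by omega)
    have := hl.cons hk hw'
    rw [Equiv.mul_swap_mul_self] at this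
    exact ⟨_, this⟩

end ReducedWords

section TotallyNonnegative

variable {n : ℕ} {k k' : Fin n}

open Matrix

lemma totNonneg_iff {x : Mat n} : totNonneg x ↔
    ∀ (m : ℕ) (f g : Fin m → Fin n), StrictMono f → StrictMono g →
      0 ≤ (x.submatrix f g).det := by
  constructor
  · intro h m f g hf hg
    have hI : (Finset.univ.image f).card = m := by
      rw [Finset.card_image_of_injective _ hf.injective, Finset.card_univ, Fintype.card_fin]
    have hJ : (Finset.univ.image g).card = m := by
      rw [Finset.card_image_of_injective _ hg.injective, Finset.card_univ, Fintype.card_fin]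
    have h1 := h m _ _ hI hJ
    rw [minorOf, ← Finset.orderEmbOfFin_unique hI (fun a => by simp) hf,
      ← Finset.orderEmbOfFin_unique hJ (fun a => by simp) hg] at h1
    exact h1
  · intro h m I J hI hJ
    exact h m _ _ (I.orderEmbOfFin hI).strictMono (J.orderEmbOfFin hJ).strictMono

lemma totNonneg.apply_nonneg {x : Mat n} (hx : totNonneg x) (i j : Fin n) : 0 ≤ x i j := by
  have := totNonneg_iff.1 hx 1 (fun _ => i) (fun _ => j) (Subsingleton.strictMono _)
    (Subsingleton.strictMono _)
  rwa [det_fin_one, submatrix_apply] at this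

lemma totNonneg_one : totNonneg (1 : Mat n) := by
  refine totNonneg_iff.2 fun m f g hf hg => ?_
  by_cases h : Set.range f ⊆ Set.range g
  · have h1 : Set.range f = Set.range g := by
      refine Set.eq_of_subset_of_ncard_le h ?_ (Set.toFinite _)
      rw [← Set.image_univ, ← Set.image_univ, Set.ncard_image_of_injective _ hf.injective,
        Set.ncard_image_of_injective _ hg.injective]
    rw [(hf.range_inj hg).1 h1, submatrix_one _ hg.injective, det_one]
    exact zero_le_one
  · rw [Set.not_subset] at h
    obtain ⟨_, ⟨a, rfl⟩, ha⟩ := h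
    rw [det_eq_zero_of_row_eq_zero a]
    intro b
    rw [submatrix_apply, one_apply_ne]
    exact fun h => ha ⟨b, h.symm⟩

section ColumnOperation

variable {m : ℕ} {f g : Fin m → Fin n} {Z : Mat n} {t : ℝ}

lemma submatrix_mul_transvection_of_forall_ne (h : ∀ a, g a ≠ k') :
    (Z * transvection k k' t).submatrix f g = Z.submatrix f g := by
  ext a b
  rw [submatrix_apply, submatrix_apply, mul_transvection_apply, if_neg (h b)]

lemma det_submatrix_mul_transvection (hg : Function.Injective g) {b : Fin m} (hb : g b = k') :
    ((Z * transvection k k' t).submatrix f g).det =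
      (Z.submatrix f g).det + t * (Z.submatrix f (Function.update g b k)).det := by
  have h1 : (Z * transvection k k' t).submatrix f g = (Z.submatrix f g).updateCol b
      ((fun a => Z (f a) (g b)) + t • fun a => Z (f a) k) := by
    ext a c
    rw [submatrix_apply, mul_transvection_apply, updateCol_apply]
    rcases eq_or_ne c b with rfl | hc
    · simp [hb]
    · have : g c ≠ k' := fun h => hc (hg (h.trans hb.symm))
      simp [hc, this]
  have h2 : (Z.submatrix f g).updateCol b (fun a => Z (f a) (g b)) = Z.submatrix f g := by
    ext a c
    rw [updateCol_apply]
    split_ifs with h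
    · rw [h, submatrix_apply]
    · rfl
  have h3 : (Z.submatrix f g).updateCol b (fun a => Z (f a) k) =
      Z.submatrix f (Function.update g b k) := by
    ext a c
    rw [updateCol_apply, submatrix_apply, submatrix_apply, Function.update_apply]
    split_ifs <;> rfl
  rw [h1, det_updateCol_add, det_updateCol_smul, h2, h3]

lemma det_submatrix_update_eq_zero {a b : Fin m} (hab : a ≠ b) (ha : g a = k) :
    (Z.submatrix f (Function.update g b k)).det = 0 :=
  det_zero_of_column_eq hab fun c => by simp [hab, ha]

lemma strictMono_update (hk : (k : ℕ) + 1 = k') (hg : StrictMono g) {b : Fin m} (hb : g b = k')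
    (h : ∀ a, g a ≠ k) : StrictMono (Function.update g b k) := by
  intro i j hij
  have h1 := hg hij
  have h2 := h i
  have h3 := h j
  rw [Function.update_apply, Function.update_apply]
  rw [Fin.lt_def] at *
  rw [ne_eq, Fin.ext_iff] at h2 h3
  split_ifs with hi hj hj
  · omega
  · rw [hi, hb] at h1
    omega
  · rw [hj, hb] at h1
    omega
  · exact h1

end ColumnOperation

lemma totNonneg.mul_transvection (hk : (k : ℕ) + 1 = k') {Z : Mat n} (hZ : totNonneg Z) {t : ℝ}
    (ht : 0 ≤ t) : totNonneg (Z * transvection k k' t) := by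
  rw [totNonneg_iff] at hZ ⊢
  intro m f g hf hg
  by_cases h : ∃ b, g b = k'
  · obtain ⟨b, hb⟩ := h
    rw [det_submatrix_mul_transvection hg.injective hb]
    refine add_nonneg (hZ m f g hf hg) (mul_nonneg ht ?_)
    by_cases ha : ∃ a, g a = k
    · obtain ⟨a, ha⟩ := ha
      rw [det_submatrix_update_eq_zero _ ha]
      rintro rfl
      rw [ha, Fin.ext_iff] at hb
      omega
    · push Not at ha
      exact hZ m f _ hf (strictMono_update hk hg hb ha)
  · push Not at h
    rw [submatrix_mul_transvection_of_forall_ne h]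
    exact hZ m f g hf hg

/-- The product of elementary matrices along a word, all with the same parameter. -/
def wordProd (t : ℝ) : List (Fin n × Fin n) → Mat n
  | [] => 1
  | p :: l => wordProd t l * transvection p.1 p.2 t

lemma IsReducedWord.totNonneg_mul_wordProd {u : Equiv.Perm (Fin n)} {l : List (Fin n × Fin n)}
    (h : IsReducedWord u l) {M : Mat n} (hM : totNonneg M) {t : ℝ} (ht : 0 ≤ t) :
    totNonneg (M * wordProd t l) := by
  induction h with
  | nil => simpa [wordProd] using hM
  | cons _ hk hw ih =>
    rw [wordProd, ← Matrix.mul_assoc]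
    exact ih.mul_transvection hk ht

lemma upperUni.det_submatrix_castLE {M : Mat n} (hM : upperUni M) {m : ℕ} (hm : m ≤ n) :
    (M.submatrix (Fin.castLE hm) (Fin.castLE hm)).det = 1 :=
  upperUni.det ⟨fun _ => hM.1 _, fun _ _ h => hM.2 _ _ h⟩

lemma IsReducedWord.minor_pos {u : Equiv.Perm (Fin n)} {l : List (Fin n × Fin n)}
    (h : IsReducedWord u l) {M : Mat n} (hM : totNonneg M) (hM' : upperUni M) {t : ℝ}
    (ht : 0 < t) {m : ℕ} (hm : m ≤ n) {g : Fin m → Fin n} (hg : StrictMono g)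
    (hug : ∀ a, (u (g a) : ℕ) < m) :
    0 < ((M * wordProd t l).submatrix (Fin.castLE hm) g).det := by
  induction h generalizing g with
  | nil =>
    have hmono : StrictMono fun a => (⟨g a, hug a⟩ : Fin m) := fun a b hab => hg hab
    have h1 := Subsingleton.elim (hmono.orderIsoOfSurjective _
      (Finite.surjective_of_injective hmono.injective)) (OrderIso.refl (Fin m))
    have h2 : g = Fin.castLE hm := by
      ext a
      have h2 : (⟨g a, hug a⟩ : Fin m) = a := DFunLike.congr_fun h1 a
      simpa [Fin.ext_iff] using h2
    rw [h2, wordProd, Matrix.mul_one, hM'.det_submatrix_castLE hm]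
    exact one_pos
  | @cons w l k k' hl hk hw ih =>
    rw [wordProd, ← Matrix.mul_assoc]
    have hfix : ∀ c, g c ≠ k → g c ≠ k' → (w (g c) : ℕ) < m := by
      intro c h1 h2
      have := hug c
      rwa [Equiv.Perm.mul_apply, Equiv.swap_apply_of_ne_of_ne h1 h2] at this
    have hk1 : ∀ c, g c = k → (w k' : ℕ) < m := by
      intro c h1
      have := hug c
      rwa [Equiv.Perm.mul_apply, h1, Equiv.swap_apply_left] at this
    have hk2 : ∀ c, g c = k' → (w k : ℕ) < m := by
      intro c h1
      have := hug c
      rwa [Equiv.Perm.mul_apply, h1, Equiv.swap_apply_right] at this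
    rw [Fin.lt_def] at hw
    by_cases hb : ∃ b, g b = k'
    · obtain ⟨b, hb⟩ := hb
      rw [det_submatrix_mul_transvection hg.injective hb]
      by_cases ha : ∃ a, g a = k
      · obtain ⟨a, ha⟩ := ha
        rw [det_submatrix_update_eq_zero _ ha, mul_zero, add_zero]
        · refine ih hg fun c => ?_
          by_cases h1 : g c = k
          · rw [h1]
            exact hk2 b hb
          by_cases h2 : g c = k'
          · rw [h2]
            exact hk1 a ha
          exact hfix c h1 h2
        · rintro rfl
          rw [ha, Fin.ext_iff] at hb
          omega
      · push Not at ha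
        refine add_pos_of_nonneg_of_pos ?_ (mul_pos ht ?_)
        · exact totNonneg_iff.1 (hl.totNonneg_mul_wordProd hM ht.le) m _ g
            (Fin.strictMono_castLE hm) hg
        · refine ih (strictMono_update hk hg hb ha) fun c => ?_
          rw [Function.update_apply]
          split_ifs with hc
          · exact hk2 b hb
          · exact hfix c (ha c) fun h => hc (hg.injective (h.trans hb.symm))
    · push Not at hb
      rw [submatrix_mul_transvection_of_forall_ne hb]
      refine ih hg fun c => ?_
      by_cases h1 : g c = k
      · rw [h1]
        exact hw.trans (hk1 c h1)
      · exact hfix c h1 (hb c)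

lemma leadBlock_det (k : Fin n) (N : Mat n) :
    (leadBlock k N).det = (N.toSquareBlockProp fun i => i ≤ k).det := by
  rw [twoBlockTriangular_det (leadBlock k N) fun i => i ≤ k]
  · have h1 : (leadBlock k N).toSquareBlockProp (fun i => i ≤ k) =
        N.toSquareBlockProp fun i => i ≤ k := by
      ext ⟨i, hi⟩ ⟨j, hj⟩
      simp [leadBlock, toSquareBlockProp, hi, hj]
    have h2 : (leadBlock k N).toSquareBlockProp (fun i => ¬i ≤ k) = 1 := by
      ext ⟨i, hi⟩ ⟨j, hj⟩
      simp [leadBlock, toSquareBlockProp, hi, one_apply]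
    rw [h1, h2, det_one, mul_one]
  · intro i hi j hj
    have : i ≠ j := by
      rintro rfl
      exact hi hj
    simp [leadBlock, hi, this]

lemma hasGauss_of_minor_ne_zero {u : Equiv.Perm (Fin n)} {Z : Mat n}
    (h : ∀ (m : ℕ) (hm : m ≤ n) (g : Fin m → Fin n), StrictMono g →
      (∀ a, (u (g a) : ℕ) < m) → (Z.submatrix (Fin.castLE hm) g).det ≠ 0) :
    hasGauss (Z * permMat u⁻¹) := by
  refine hasGauss_of_leadBlock fun k => ?_
  have hm : (k : ℕ) + 1 ≤ n := k.isLt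
  have hcard : (Finset.univ.filter fun j => u j ≤ k).card = k + 1 := by
    have : (Finset.univ.filter fun j => u j ≤ k) = (Finset.Iic k).map u.symm.toEmbedding := by
      ext j
      simp
    rw [this, Finset.card_map, Fin.card_Iic]
  set g := (Finset.univ.filter fun j => u j ≤ k).orderEmbOfFin hcard
  have hg : ∀ a, u (g a) ≤ k := fun a => by
    have := Finset.orderEmbOfFin_mem _ hcard a
    exact (Finset.mem_filter.1 this).2
  have hcard' : Fintype.card (Fin (k + 1)) = Fintype.card {i // i ≤ k} := by
    rw [Fintype.card_fin, Fintype.card_subtype, ← Fin.card_Iic]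
    congr
    ext i
    simp
  let e₁ : Fin (k + 1) ≃ {i // i ≤ k} := Equiv.ofBijective
    (fun a => ⟨Fin.castLE hm a, by
      rw [Fin.le_def]; exact Nat.lt_succ_iff.1 a.isLt⟩)
    ((Fintype.bijective_iff_injective_and_card _).2 ⟨fun a b hab =>
      Fin.castLE_injective hm (congrArg Subtype.val hab), hcard'⟩)
  let e₂ : Fin (k + 1) ≃ {i // i ≤ k} := Equiv.ofBijective (fun a => ⟨u (g a), hg a⟩)
    ((Fintype.bijective_iff_injective_and_card _).2 ⟨fun a b hab =>
      g.injective (u.injective (congrArg Subtype.val hab)), hcard'⟩)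
  have e : ((Z * permMat u⁻¹).toSquareBlockProp fun i => i ≤ k).submatrix e₁ e₂ =
      Z.submatrix (Fin.castLE hm) g := by
    ext a b
    simp [e₁, e₂, toSquareBlockProp, mul_permMat_apply]
  rw [leadBlock_det, ← abs_ne_zero, ← abs_det_submatrix_equiv_equiv e₁ e₂, e, abs_ne_zero]
  exact h _ hm g g.strictMono fun a => Nat.lt_succ_iff.2 (hg a)

lemma IsReducedWord.hasGauss_mul_wordProd {u : Equiv.Perm (Fin n)} {l : List (Fin n × Fin n)}
    (h : IsReducedWord u l) {M : Mat n} (hM : totNonneg M) (hM' : upperUni M) {t : ℝ}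
    (ht : 0 < t) : hasGauss (M * wordProd t l * permMat u⁻¹) :=
  hasGauss_of_minor_ne_zero fun _ hm _ hg hug => (h.minor_pos hM hM' ht hm hg hug).ne'

end TotallyNonnegative

section PositiveCells

variable {n : ℕ} {k k' : Fin n} {u : Equiv.Perm (Fin n)} {l : List (Fin n × Fin n)}

open Matrix Filter Topology

/-- The set of products of elementary matrices along a word with positive parameters. -/
def posCell : List (Fin n × Fin n) → Set (Mat n)
  | [] => {1}
  | p :: l => {y | ∃ z ∈ posCell l, ∃ t : ℝ, 0 < t ∧ y = z * transvection p.1 p.2 t}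

/-- The set of products of elementary matrices along a word with nonnegative parameters. -/
def nonnegCell : List (Fin n × Fin n) → Set (Mat n)
  | [] => {1}
  | p :: l => {y | ∃ z ∈ nonnegCell l, ∃ t : ℝ, 0 ≤ t ∧ y = z * transvection p.1 p.2 t}

lemma posCell_subset_nonnegCell (l : List (Fin n × Fin n)) : posCell l ⊆ nonnegCell l := by
  induction l with
  | nil => exact subset_rfl
  | cons p l ih =>
    rintro _ ⟨z, hz, t, ht, rfl⟩
    exact ⟨z, ih hz, t, ht.le, rfl⟩

lemma wordProd_mem_posCell (l : List (Fin n × Fin n)) {t : ℝ} (ht : 0 < t) :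
    wordProd t l ∈ posCell l := by
  induction l with
  | nil => rfl
  | cons p l ih => exact ⟨_, ih, t, ht, rfl⟩

lemma IsReducedWord.nonnegCell_subset (h : IsReducedWord u l) {z : Mat n}
    (hz : z ∈ nonnegCell l) : upperUni z ∧ totNonneg z := by
  induction h generalizing z with
  | nil =>
    rw [nonnegCell, Set.mem_singleton_iff] at hz
    rw [hz]
    exact ⟨upperUni_one, totNonneg_one⟩
  | @cons w l k k' _ hk _ ih =>
    have hlt : k < k' := by rw [Fin.lt_def]; omega
    obtain ⟨z, hz, t, ht, rfl⟩ := hz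
    exact ⟨(ih hz).1.mul (transvection_upperUni hlt t),
      (ih hz).2.mul_transvection hk ht⟩

lemma IsReducedWord.posCell_subset (h : IsReducedWord u l) {z : Mat n} (hz : z ∈ posCell l) :
    z ∈ Ncell u := by
  induction h generalizing z with
  | nil =>
    rw [posCell, Set.mem_singleton_iff] at hz
    rw [hz]
    exact ⟨upperUni_one, 1, 1, lowerTriInv_one, lowerTriInv_one, by simp [permMat_one]⟩
  | cons _ hk hw ih =>
    obtain ⟨z, hz, t, ht, rfl⟩ := hz
    exact (Amat_mul_transvection hk hw (ih hz) ht.ne').1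

lemma IsReducedWord.mem_posCell_or (h : IsReducedWord u l) {z : Mat n} (hz : z ∈ nonnegCell l) :
    z ∈ posCell l ∨ ∃ w, z ∈ doubleCosetBm w ∧ invNum w < l.length := by
  induction h generalizing z with
  | nil => exact Or.inl hz
  | @cons w l k k' hl hk hw ih =>
    obtain ⟨z, hz, t, ht, rfl⟩ := hz
    rw [List.length_cons]
    rcases ht.eq_or_lt with rfl | ht
    · right
      simp only [transvection_zero, Matrix.mul_one]
      rcases ih hz with h | ⟨v, hv, hv'⟩
      · exact ⟨w, (hl.posCell_subset h).2, by rw [hl.invNum_eq]; omega⟩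
      · exact ⟨v, hv, by omega⟩
    · rcases ih hz with h | ⟨v, hv, hv'⟩
      · exact Or.inl ⟨z, h, t, ht, rfl⟩
      · right
        rcases mul_transvection_mem_or hk hv t with h | h
        · exact ⟨v, h, by omega⟩
        · have := invNum_mul_swap_le hk v
          exact ⟨_, h, by omega⟩

lemma IsReducedWord.mem_posCell (h : IsReducedWord u l) {z : Mat n} (hz : z ∈ nonnegCell l)
    (hzu : z ∈ Ncell u) : z ∈ posCell l := by
  rcases h.mem_posCell_or hz with h' | ⟨w, hw, hw'⟩
  · exact h'
  · rw [doubleCosetBm_disjoint hzu.2 hw, h.invNum_eq] at hw'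
    exact absurd hw' (lt_irrefl _)

lemma continuous_transvection (k k' : Fin n) :
    Continuous fun t : ℝ => (transvection k k' t : Mat n) := by
  refine continuous_matrix fun i j => ?_
  simp only [transvection_apply]
  split_ifs
  · exact continuous_const.add continuous_id
  · exact continuous_const

lemma continuous_wordProd (l : List (Fin n × Fin n)) : Continuous fun t : ℝ => wordProd t l := by
  induction l with
  | nil => exact continuous_const
  | cons p l ih => exact ih.matrix_mul (continuous_transvection p.1 p.2)

lemma isClosed_mul_transvection (hk : k ≠ k') {C : Set (Mat n)} (hC : IsClosed C)
    (h1 : ∀ z ∈ C, z k k = 1) (h0 : ∀ z ∈ C, 0 ≤ z k k') :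
    IsClosed {y | ∃ z ∈ C, ∃ t : ℝ, 0 ≤ t ∧ y = z * transvection k k' t} := by
  have hB : ∀ B : ℝ, IsClosed {y : Mat n | ∃ t ∈ Set.Icc 0 B, y * transvection k k' (-t) ∈ C} := by
    intro B
    have hc : Continuous fun p : Mat n × Set.Icc 0 B => p.1 * transvection k k' (-(p.2 : ℝ)) :=
      continuous_fst.matrix_mul
        ((continuous_transvection k k').comp (continuous_subtype_val.comp continuous_snd).neg)
    have := isClosedMap_fst_of_compactSpace _ (hC.preimage hc)
    convert this using 1
    ext y
    simp
  have hval : Continuous fun y : Mat n => y k k' := continuous_id.matrix_elem k k'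
  refine isClosed_of_closure_subset fun y hy => ?_
  have hy' : y ∈ {z : Mat n | ∃ t ∈ Set.Icc 0 (y k k' + 1), z * transvection k k' (-t) ∈ C} := by
    refine (hB _).mem_of_frequently_of_tendsto ?_ tendsto_id
    refine ((mem_closure_iff_frequently.1 hy).and_eventually
      (hval.continuousAt.eventually_lt_const (lt_add_one _))).mono ?_
    rintro _ ⟨⟨z, hz, t, ht, rfl⟩, hlt⟩
    rw [mul_transvection_apply, if_pos rfl, h1 z hz] at hlt
    refine ⟨t, ⟨ht, by linarith [h0 z hz]⟩, ?_⟩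
    rwa [id, Matrix.mul_assoc, transvection_mul_neg hk, Matrix.mul_one]
  obtain ⟨t, ht, hyt⟩ := hy'
  refine ⟨_, hyt, t, ht.1, ?_⟩
  rw [Matrix.mul_assoc, transvection_neg_mul hk, Matrix.mul_one]

lemma IsReducedWord.isClosed_nonnegCell (h : IsReducedWord u l) : IsClosed (nonnegCell l) := by
  induction h with
  | nil => exact isClosed_singleton
  | @cons w l k k' hl hk _ ih =>
    have hne : k ≠ k' := by rintro rfl; omega
    exact isClosed_mul_transvection hne ih (fun z hz => (hl.nonnegCell_subset hz).1.1 _)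
      fun z hz => (hl.nonnegCell_subset hz).2.apply_nonneg _ _

lemma eq_one_of_mem_Ncell_one {z : Mat n} (hz : z ∈ Ncell 1) : z = 1 := by
  obtain ⟨hz, b, c, hb, hc, e⟩ := hz
  rw [permMat_one, Matrix.mul_one] at e
  have hl := hb.mul hc
  rw [← e] at hl
  ext i j
  rcases lt_trichotomy i j with h | rfl | h
  · rw [hl.2 _ _ h, one_apply_ne h.ne]
  · rw [hz.1, one_apply_eq]
  · rw [hz.2 _ _ h, one_apply_ne h.ne']

lemma IsReducedWord.eventually_mem_posCell (h : IsReducedWord u l) {z₀ : Mat n}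
    (hz₀ : z₀ ∈ posCell l) : ∀ᶠ z in 𝓝[Ncell u] z₀, z ∈ posCell l := by
  induction h generalizing z₀ with
  | nil =>
    filter_upwards [self_mem_nhdsWithin] with z hz
    exact eq_one_of_mem_Ncell_one hz
  | @cons w l k k' hl hk hw ih =>
    have hne : k ≠ k' := by rintro rfl; omega
    obtain ⟨z₁, hz₁, t, ht, rfl⟩ := hz₀
    obtain ⟨hmem, hA⟩ := Amat_mul_transvection hk hw (hl.posCell_subset hz₁) ht.ne'
    set u := w * Equiv.swap k k'
    set z₀ := z₁ * transvection k k' t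
    have hcont : ContinuousWithinAt (fun z => Amat u z k' k) (Ncell u) z₀ := by
      have := ((continuousOn_Amat u).mono fun z hz => hasGauss_of_mem_Ncell hz) z₀ hmem
      exact (continuous_id.matrix_elem k' k).continuousAt.comp_continuousWithinAt this
    have hpos : ∀ᶠ z in 𝓝[Ncell u] z₀, 0 < Amat u z k' k :=
      hcont.eventually_const_lt ((inv_pos.2 ht).trans_eq hA.symm)
    have hA' : Amat u z₀ k' k ≠ 0 := by rw [hA]; exact inv_ne_zero ht.ne'
    have hφ : ContinuousWithinAt (fun z => z * transvection k k' (-(Amat u z k' k)⁻¹))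
        (Ncell u) z₀ := by
      have h2 : Continuous fun p : Mat n × ℝ => p.1 * transvection k k' p.2 :=
        continuous_fst.matrix_mul ((continuous_transvection k k').comp continuous_snd)
      exact h2.continuousAt.comp_continuousWithinAt
        (continuousWithinAt_id.prodMk (hcont.inv₀ hA').neg)
    have hφ₀ : z₀ * transvection k k' (-(Amat u z₀ k' k)⁻¹) = z₁ := by
      rw [hA, inv_inv, Matrix.mul_assoc, transvection_mul_neg hne, Matrix.mul_one]
    have hmap : ∀ᶠ z in 𝓝[Ncell u] z₀,
        z * transvection k k' (-(Amat u z k' k)⁻¹) ∈ Ncell w := by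
      filter_upwards [self_mem_nhdsWithin, hpos] with z hz hz'
      have := mul_transvection_mem_Ncell hk hz hz'.ne'
      rwa [Equiv.mul_swap_mul_self] at this
    have htend := tendsto_nhdsWithin_iff.2 ⟨hφ.tendsto, hmap⟩
    rw [hφ₀] at htend
    filter_upwards [htend.eventually (ih hz₁), hpos] with z hz hz'
    refine ⟨_, hz, (Amat u z k' k)⁻¹, inv_pos.2 hz', ?_⟩
    rw [Matrix.mul_assoc, transvection_neg_mul hne, Matrix.mul_one]

/-- The contraction of the unitriangular group onto the identity. -/
def contract (σ : ℝ) (x : Mat n) : Mat n :=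
  of fun i j => if i ≤ j then σ ^ ((j : ℕ) - i) * x i j else 0

lemma continuous_contract (x : Mat n) : Continuous fun σ => contract σ x := by
  refine continuous_matrix fun i j => ?_
  simp only [contract, of_apply]
  split_ifs
  · exact (continuous_pow _).mul continuous_const
  · exact continuous_const

lemma upperUni.contract {x : Mat n} (hx : upperUni x) (σ : ℝ) : upperUni (contract σ x) :=
  ⟨fun i => by simp [BruhatTNN.contract, hx.1],
    fun i j h => by simp [BruhatTNN.contract, h.not_ge]⟩

lemma upperUni.contract_zero {x : Mat n} (hx : upperUni x) : BruhatTNN.contract 0 x = 1 := by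
  ext i j
  rcases lt_trichotomy i j with h | rfl | h
  · have : (j : ℕ) - i ≠ 0 := by rw [Fin.lt_def] at h; omega
    simp [BruhatTNN.contract, one_apply_ne h.ne, this]
  · rw [(hx.contract 0).1, one_apply_eq]
  · rw [(hx.contract 0).2 _ _ h, one_apply_ne h.ne']

lemma upperUni.contract_one {x : Mat n} (hx : upperUni x) : BruhatTNN.contract 1 x = x := by
  ext i j
  by_cases h : i ≤ j
  · simp [BruhatTNN.contract, h]
  · rw [(hx.contract 1).2 _ _ (not_le.1 h), hx.2 _ _ (not_le.1 h)]

lemma totNonneg.contract {x : Mat n} (hx : totNonneg x) (hx' : upperUni x) {σ : ℝ} (hσ : 0 < σ) :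
    totNonneg (contract σ x) := by
  rw [totNonneg_iff] at hx ⊢
  intro m f g hf hg
  have e : (BruhatTNN.contract σ x).submatrix f g =
      of fun a b => (σ ^ (f a : ℕ))⁻¹ * (of fun a b => σ ^ (g b : ℕ) * x.submatrix f g a b) a b := by
    ext a b
    simp only [BruhatTNN.contract, submatrix_apply, of_apply]
    split_ifs with h
    · rw [Fin.le_def] at h
      rw [pow_sub₀ _ hσ.ne' h]
      ring
    · rw [hx'.2 _ _ (not_le.1 h)]
      ring
  rw [e, det_mul_column, det_mul_row]
  exact mul_nonneg (Finset.prod_nonneg fun _ _ => by positivity)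
    (mul_nonneg (Finset.prod_nonneg fun _ _ => by positivity) (hx m f g hf hg))

lemma wordProd_zero (l : List (Fin n × Fin n)) : wordProd 0 l = 1 := by
  induction l with
  | nil => rfl
  | cons p l ih => rw [wordProd, ih, transvection_zero, Matrix.mul_one]

/-- The projection of a totally nonnegative matrix onto `N^u` lies in the positive cell of any
reduced word of `u`. -/
lemma IsReducedWord.piMap_mem_posCell (h : IsReducedWord u l) {x : Mat n} (hx : upperUni x)
    (hx' : totNonneg x) (hxu : hasGauss (x * permMat u⁻¹)) : piMap u x ∈ posCell l := by
  let f : unitInterval → Mat n := fun σ => contract σ x * wordProd (1 - σ) l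
  have hf : Continuous f := ((continuous_contract x).comp continuous_subtype_val).matrix_mul
    ((continuous_wordProd l).comp (continuous_const.sub continuous_subtype_val))
  have hf0 : f 0 = wordProd 1 l := by simp [f, hx.contract_zero]
  have hf1 : f 1 = x := by simp [f, hx.contract_one, wordProd_zero]
  have hmem0 : wordProd 1 l ∈ posCell l := wordProd_mem_posCell l one_pos
  have hfu : ∀ σ, upperUni (f σ) ∧ hasGauss (f σ * permMat u⁻¹) := by
    intro σ
    refine ⟨(hx.contract σ).mul ?_, ?_⟩
    · rcases σ.2.2.eq_or_lt with h1 | h1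
      · rw [h1, sub_self, wordProd_zero]
        exact upperUni_one
      · exact (h.posCell_subset (wordProd_mem_posCell l (sub_pos.2 h1))).1
    · rcases eq_or_ne σ 0 with rfl | h0
      · rw [hf0]
        exact hasGauss_of_mem_Ncell (h.posCell_subset hmem0)
      rcases eq_or_ne σ 1 with rfl | h1
      · rwa [hf1]
      exact h.hasGauss_mul_wordProd (hx'.contract hx (unitInterval.pos_iff_ne_zero.2 h0))
        (hx.contract σ) (sub_pos.2 (unitInterval.lt_one_iff_ne_one.2 h1))
  have hg : Continuous fun σ => piMap u (f σ) := (continuousOn_piMap u).comp_continuous hf hfu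
  have hgu : ∀ σ, piMap u (f σ) ∈ Ncell u := by
    intro σ
    obtain ⟨L, Am, Ap, hfac⟩ := exists_isFactorization (hfu σ).2
    exact hfac.piMap_mem (hfu σ).1
  have hclosed : IsClosed {σ | piMap u (f σ) ∈ posCell l} := by
    convert h.isClosed_nonnegCell.preimage hg using 1
    ext σ
    exact ⟨fun hσ => posCell_subset_nonnegCell l hσ, fun hσ => h.mem_posCell hσ (hgu σ)⟩
  have hopen : IsOpen {σ | piMap u (f σ) ∈ posCell l} := by
    refine isOpen_iff_mem_nhds.2 fun σ hσ => ?_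
    exact (tendsto_nhdsWithin_iff.2 ⟨hg.continuousAt, Eventually.of_forall hgu⟩).eventually
      (h.eventually_mem_posCell hσ)
  have huniv := IsClopen.eq_univ ⟨hclosed, hopen⟩ ⟨0, by
    rw [Set.mem_ofPred_eq, hf0, piMap_of_mem_Ncell (h.posCell_subset hmem0)]
    exact hmem0⟩
  have h1 : (1 : unitInterval) ∈ {σ | piMap u (f σ) ∈ posCell l} := huniv ▸ Set.mem_univ _
  rwa [Set.mem_ofPred_eq, hf1] at h1

end PositiveCells

theorem statement11 (n : ℕ) (hn : 1 ≤ n) (u : Equiv.Perm (Fin n)) :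
    (∀ xu ∈ Ncell u, ∀ xp ∈ Ngrp u,
      upperUni (xu * xp) ∧ hasGauss ((xu * xp) * permMat u⁻¹)) ∧
    (∀ x : Mat n, upperUni x → hasGauss (x * permMat u⁻¹) →
      hasGauss (Amat u x) ∧
      hasGauss (permMat u * gaussMinus (Amat u x)) ∧
      piMap u x ∈ Ncell u ∧
      gaussPlus (Amat u x) ∈ Ngrp u ∧
      x = piMap u x * gaussPlus (Amat u x) ∧
      (∀ xu ∈ Ncell u, ∀ xp ∈ Ngrp u, x = xu * xp →
        xu = piMap u x ∧ xp = gaussPlus (Amat u x)) ∧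
      (totNonneg x → totNonneg (piMap u x) ∧ piMap u x ∈ Ycirc u)) := by
  refine ⟨fun xu hxu xp hxp => ?_, fun x hx hG => ?_⟩
  · obtain ⟨L, Am, h⟩ := exists_isFactorization_of_mem hxu hxp
    exact ⟨hxu.1.mul hxp.1, h.hasGauss⟩
  obtain ⟨L, Am, Ap, h⟩ := exists_isFactorization hG
  have hmem := h.piMap_mem hx
  refine ⟨h.hasGauss_Amat, h.hasGauss_perm_mul hx, hmem, ?_, ?_, ?_, fun hpos => ?_⟩
  · rw [h.gaussPlus_Amat]
    exact mem_Ngrp_iff.2 ⟨h.plus, h.plus_tri⟩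
  · rw [h.gaussPlus_Amat]
    exact h.eq_piMap_mul hx
  · rintro xu hxu xp hxp rfl
    obtain ⟨L', Am', h'⟩ := exists_isFactorization_of_mem hxu hxp
    refine ⟨?_, h'.gaussPlus_Amat.symm⟩
    rw [h'.piMap_eq hx, Matrix.mul_assoc, Matrix.mul_nonsing_inv _ h'.plus.isUnit, Matrix.mul_one]
  · obtain ⟨l, hl⟩ := exists_isReducedWord u
    have h1 := hl.piMap_mem_posCell hx hpos hG
    have h2 := (hl.nonnegCell_subset (posCell_subset_nonnegCell l h1)).2
    exact ⟨h2, hmem.1, h2, hmem.2⟩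

end BruhatTNN
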